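/- arXiv:2503.03551 — 2 statements merged into one kernel-verified Lean document; each statement's English description precedes it below -/
import Mathlib

section
/- Let A, B be finite algebras in a locally finite Taylor variety and let ρ ∈ Con(A), σ ∈ Con(B) be meet-irreducible with unique upper covers ρ⁺, σ⁺ respectively. If ρ⁺/ρ and σ⁺/σ are both nonabelian and there exists a good bridge from (A,ρ) to (B,σ), then A/ρ ≅ B/σ. -/
namespace Zhuk

/-- A signature: a type of operation symbols with arities. -/
structure Signature where
  ops : Type
  arity : ops → ℕ

/-- An algebra structure of signature `S` on carrier `A`. -/
class SAlg (S : Signature) (A : Type) where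
  interp : (o : S.ops) → (Fin (S.arity o) → A) → A

variable {S : Signature}

/-- Componentwise algebra structure on a product. -/
instance prodSAlg {A B : Type} [SAlg S A] [SAlg S B] : SAlg S (A × B) :=
  ⟨fun o x => (SAlg.interp o fun i => (x i).1, SAlg.interp o fun i => (x i).2)⟩

/-- A subset closed under all the operations. -/
def IsSubuniverse (S : Signature) {A : Type} [SAlg S A] (R : Set A) : Prop :=
  ∀ (o : S.ops) (x : Fin (S.arity o) → A), (∀ i, x i ∈ R) → SAlg.interp o x ∈ R

/-- The algebra structure on (the subtype of) a subuniverse. -/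
def subAlg {A : Type} [SAlg S A] (R : Set A) (h : IsSubuniverse S R) : SAlg S ↥R :=
  ⟨fun o x => ⟨SAlg.interp o fun i => (x i).1, h o _ fun i => (x i).2⟩⟩

/-- Terms of signature `S` in `n` variables. -/
inductive STerm (S : Signature) (n : ℕ) : Type
  | var : Fin n → STerm S n
  | app (o : S.ops) : (Fin (S.arity o) → STerm S n) → STerm S n

/-- Evaluation of a term in an algebra. -/
def STerm.eval {A : Type} [SAlg S A] {n : ℕ} : STerm S n → (Fin n → A) → A
  | .var i, v => v i
  | .app o ts, v => SAlg.interp o fun i => (ts i).eval v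

/-- The diagonal (smallest) congruence `0_A`. -/
def diag (A : Type) : Set (A × A) := {p | p.1 = p.2}

/-- Relational composition. -/
def rcomp {A B C : Type} (R : Set (A × B)) (T : Set (B × C)) : Set (A × C) :=
  {p | ∃ b, (p.1, b) ∈ R ∧ (b, p.2) ∈ T}

/-- Relational inverse. -/
def rinv {A B : Type} (R : Set (A × B)) : Set (B × A) := {p | (p.2, p.1) ∈ R}

/-- Transitive closure of a binary relation (as a set of pairs). -/
def transCl {A : Type} (R : Set (A × A)) : Set (A × A) :=
  {p | Relation.TransGen (fun a b => (a, b) ∈ R) p.1 p.2}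

/-- `R` is stable under (saturated with respect to) `ρ`:  `R = ρ ∘ R ∘ ρ`. -/
def Saturated {A : Type} (ρ R : Set (A × A)) : Prop := rcomp ρ (rcomp R ρ) = R

/-- A congruence: a subuniverse of `A²` which is an equivalence relation. -/
def IsCongruence (S : Signature) {A : Type} [SAlg S A] (θ : Set (A × A)) : Prop :=
  IsSubuniverse S θ ∧ Equivalence fun a b => (a, b) ∈ θ

/-- `ρ ∈ Con*(A)`: a congruence different from the full congruence `1_A`. -/
def ConStar (S : Signature) {A : Type} [SAlg S A] (ρ : Set (A × A)) : Prop :=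
  IsCongruence S ρ ∧ ρ ≠ Set.univ

/-- The ternary centralizer relation `C(φ, θ; δ)`, via the term condition. -/
def Centralizes (S : Signature) {A : Type} [SAlg S A] (φ θ δ : Set (A × A)) : Prop :=
  ∀ (n : ℕ) (t : STerm S (n + 1)) (a b : A) (c d : Fin n → A),
    (a, b) ∈ φ → (∀ i, (c i, d i) ∈ θ) →
    (t.eval (Fin.cons a c), t.eval (Fin.cons a d)) ∈ δ →
    (t.eval (Fin.cons b c), t.eval (Fin.cons b d)) ∈ δ

/-- The centralizer `(δ : θ)`: the largest congruence `φ` with `C(φ, θ; δ)`. -/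
def centralizer (S : Signature) {A : Type} [SAlg S A] (δ θ : Set (A × A)) : Set (A × A) :=
  ⋃₀ {φ | IsCongruence S φ ∧ Centralizes S φ θ δ}

/-- A congruence of the subalgebra `A(θ) ≤ A²`, viewed ambiently as a subset of
`(A×A) × (A×A)` whose field is `θ`. -/
def IsConOn (S : Signature) {A : Type} [SAlg S A] (θ : Set (A × A))
    (Δ : Set ((A × A) × (A × A))) : Prop :=
  Δ ⊆ θ ×ˢ θ ∧ IsSubuniverse S Δ ∧ (∀ p ∈ θ, (p, p) ∈ Δ) ∧
    (∀ p q, (p, q) ∈ Δ → (q, p) ∈ Δ) ∧ (∀ p q r, (p, q) ∈ Δ → (q, r) ∈ Δ → (p, r) ∈ Δ)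

/-- `Δ_{θ,α}`: the congruence of `A(θ)` generated by `{((a,a),(b,b)) : (a,b) ∈ α}`. -/
def DeltaCon (S : Signature) {A : Type} [SAlg S A] (θ α : Set (A × A)) :
    Set ((A × A) × (A × A)) :=
  ⋂₀ {Δ | IsConOn S θ Δ ∧ ∀ a b : A, (a, b) ∈ α → ((a, a), (b, b)) ∈ Δ}

/-- Projection of a quaternary relation to its first two coordinates. -/
def pr12 {A B : Type} (T : Set (A × A × B × B)) : Set (A × A) :=
  {p | ∃ b₁ b₂, (p.1, p.2, b₁, b₂) ∈ T}

/-- Projection of a quaternary relation to its last two coordinates. -/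
def pr34 {A B : Type} (T : Set (A × A × B × B)) : Set (B × B) :=
  {q | ∃ a₁ a₂, (a₁, a₂, q.1, q.2) ∈ T}

/-- The trace of a quaternary relation. -/
def btr {A B : Type} (T : Set (A × A × B × B)) : Set (A × B) :=
  {p | (p.1, p.1, p.2, p.2) ∈ T}

/-- Zhuk's bridges: Definition 4.3 (B0*), (B1*), (B2*). -/
def IsBridge (S : Signature) {A B : Type} [SAlg S A] [SAlg S B]
    (ρ : Set (A × A)) (σ : Set (B × B)) (T : Set (A × A × B × B)) : Prop :=
  IsSubuniverse S T ∧
  (∀ a₁ a₂ b₁ b₂ a₁' a₂', (a₁, a₂, b₁, b₂) ∈ T → (a₁, a₁') ∈ ρ → (a₂, a₂') ∈ ρ →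
    (a₁', a₂', b₁, b₂) ∈ T) ∧
  (∀ a₁ a₂ b₁ b₂ b₁' b₂', (a₁, a₂, b₁, b₂) ∈ T → (b₁, b₁') ∈ σ → (b₂, b₂') ∈ σ →
    (a₁, a₂, b₁', b₂') ∈ T) ∧
  ρ ⊂ pr12 T ∧ σ ⊂ pr34 T ∧
  (∀ a₁ a₂ b₁ b₂, (a₁, a₂, b₁, b₂) ∈ T → ((a₁, a₂) ∈ ρ ↔ (b₁, b₂) ∈ σ))

/-- A bridge from `(A,ρ,L)` to `(B,σ,R)`: a bridge with prescribed anchors. -/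
def IsBridgeLR (S : Signature) {A B : Type} [SAlg S A] [SAlg S B]
    (ρ : Set (A × A)) (σ : Set (B × B)) (L : Set (A × A)) (R : Set (B × B))
    (T : Set (A × A × B × B)) : Prop :=
  IsBridge S ρ σ T ∧ pr12 T = L ∧ pr34 T = R

/-- A reflexive bridge (case `B = A`): `0_A ⊆ tr(T)`. -/
def ReflBridge {A : Type} (T : Set (A × A × A × A)) : Prop :=
  ∀ a : A, (a, a) ∈ btr T

/-- `Cov(ρ)`: the inclusion-minimal ρ-saturated subuniverses of `A²` properly containing ρ. -/
def Cov (S : Signature) {A : Type} [SAlg S A] (ρ : Set (A × A)) : Set (Set (A × A)) :=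
  {L | IsSubuniverse S L ∧ Saturated ρ L ∧ ρ ⊂ L ∧
    ∀ L', IsSubuniverse S L' → Saturated ρ L' → ρ ⊂ L' → L' ⊆ L → L' = L}

/-- `ref.tr(ρ,L)`: traces of reflexive bridges from `(A,ρ,L)` to itself. -/
def refTr (S : Signature) {A : Type} [SAlg S A] (ρ L : Set (A × A)) : Set (Set (A × A)) :=
  {γ | ∃ T : Set (A × A × A × A), IsBridgeLR S ρ ρ L L T ∧ ReflBridge T ∧ btr T = γ}

/-- `γ = Opt(ρ,L)`: `γ` is the (unique) inclusion-maximal member of `ref.tr(ρ,L)`. -/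
def IsOptOf (S : Signature) {A : Type} [SAlg S A] (ρ L γ : Set (A × A)) : Prop :=
  γ ∈ refTr S ρ L ∧ ∀ δ ∈ refTr S ρ L, γ ⊆ δ → δ = γ

/-- `ρ` is meet-irreducible with unique upper cover `ρplus`. -/
def MeetIrredWith (S : Signature) {A : Type} [SAlg S A] (ρ ρplus : Set (A × A)) : Prop :=
  IsCongruence S ρ ∧ ρ ≠ Set.univ ∧ IsCongruence S ρplus ∧ ρ ⊂ ρplus ∧
    ∀ θ, IsCongruence S θ → ρ ⊂ θ → ρplus ⊆ θ

/-- `Cov⁺(ρ) = {τ ∈ Cov(ρ) : τ ⊆ ρ⁺}`. -/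
def CovPlus (S : Signature) {A : Type} [SAlg S A] (ρ ρplus : Set (A × A)) :
    Set (Set (A × A)) :=
  {τ | τ ∈ Cov S ρ ∧ τ ⊆ ρplus}

/-- A good bridge between meet-irreducible congruences with upper covers `ρplus`, `σplus`. -/
def GoodBridge (S : Signature) {A B : Type} [SAlg S A] [SAlg S B]
    (ρ ρplus : Set (A × A)) (σ σplus : Set (B × B)) (T : Set (A × A × B × B)) : Prop :=
  IsBridge S ρ σ T ∧
    ∃ τ ∈ CovPlus S ρ ρplus, ∃ τ' ∈ CovPlus S σ σplus, ∃ T' ⊆ T,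
      IsBridgeLR S ρ σ τ τ' T' ∧ btr T' = btr T

/-- `t` (with Taylor-identity data `u v`) is idempotent on `A` and satisfies the
corresponding identities on `A`. -/
def TaylorOn (S : Signature) (A : Type) [SAlg S A] {n : ℕ} (t : STerm S n)
    (u v : Fin n → Fin n → Fin 2) : Prop :=
  (∀ a : A, t.eval (fun _ => a) = a) ∧
    ∀ (i : Fin n) (x y : A),
      t.eval (fun j => if u i j = 0 then x else y) =
        t.eval (fun j => if v i j = 0 then x else y)

/-- `A` is a Taylor algebra. -/
def IsTaylorAlg (S : Signature) (A : Type) [SAlg S A] : Prop :=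
  ∃ (n : ℕ) (t : STerm S n) (u v : Fin n → Fin n → Fin 2),
    1 < n ∧ (∀ i, u i i ≠ v i i) ∧ TaylorOn S A t u v

/-- `A` and `B` lie in a common (locally finite, as they are finite) Taylor variety:
they share a common Taylor term with common Taylor identities. -/
def CommonTaylor (S : Signature) (A B : Type) [SAlg S A] [SAlg S B] : Prop :=
  ∃ (n : ℕ) (t : STerm S n) (u v : Fin n → Fin n → Fin 2),
    1 < n ∧ (∀ i, u i i ≠ v i i) ∧ TaylorOn S A t u v ∧ TaylorOn S B t u v

/-- The quotient of `A` by (the equivalence relation of) `θ`. -/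
abbrev ConQuot {A : Type} (θ : Set (A × A)) : Type :=
  Quot (fun a b => (a, b) ∈ θ)

/-- The class of `a` in `A/θ`. -/
def ConQuot.mk {A : Type} (θ : Set (A × A)) (a : A) : ConQuot θ :=
  Quot.mk _ a

/-- The quotient algebra structure on `A/θ` (extensionally correct when `θ` is a
congruence). -/
noncomputable def quotAlg {S : Signature} {A : Type} (iA : SAlg S A) (θ : Set (A × A)) :
    SAlg S (ConQuot θ) :=
  ⟨fun o x => ConQuot.mk θ
    (@SAlg.interp S A iA o fun i => Classical.choose (Quot.exists_rep (x i)))⟩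

/-- `f` is a homomorphism with respect to the given algebra structures. -/
def IsHomI {S : Signature} {A B : Type} (iA : SAlg S A) (iB : SAlg S B) (f : A → B) : Prop :=
  ∀ (o : S.ops) (x : Fin (S.arity o) → A),
    f (@SAlg.interp S A iA o x) = @SAlg.interp S B iB o fun i => f (x i)

/-- The two algebras are isomorphic. -/
def IsoAlgI {S : Signature} {A B : Type} (iA : SAlg S A) (iB : SAlg S B) : Prop :=
  ∃ f : A ≃ B, IsHomI iA iB f

/-- The identity bridge `I_{(A,ρ,L)}`. -/
def idBridge {A : Type} (ρ L : Set (A × A)) : Set (A × A × A × A) :=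
  {p | (p.1, p.2.1) ∈ L ∧ (p.2.2.1, p.2.2.2) ∈ L ∧ (p.1, p.2.2.1) ∈ ρ ∧ (p.2.1, p.2.2.2) ∈ ρ}

/-- Composition of quaternary relations (bridges). -/
def bComp {A B C : Type} (T : Set (A × A × B × B)) (T' : Set (B × B × C × C)) :
    Set (A × A × C × C) :=
  {p | ∃ b₁ b₂, (p.1, p.2.1, b₁, b₂) ∈ T ∧ (b₁, b₂, p.2.2.1, p.2.2.2) ∈ T'}

/-- Converse of a quaternary relation (bridge). -/
def bConv {A B : Type} (T : Set (A × A × B × B)) : Set (B × B × A × A) :=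
  {p | (p.2.2.1, p.2.2.2, p.1, p.2.1) ∈ T}

/-- `Δ♭_{θ,α}`: the congruence `Δ_{θ,α}` of `A(θ)` viewed as a quaternary relation. -/
def deltaFlat (S : Signature) {A : Type} [SAlg S A] (θ α : Set (A × A)) :
    Set (A × A × A × A) :=
  {p | ((p.1, p.2.1), (p.2.2.1, p.2.2.2)) ∈ DeltaCon S θ α}

/-- `T^opt_{(A,ρ)} = I_{(A,ρ,ρ⁺)} ∘ Δ♭_{ρ⁺,(ρ:ρ⁺)} ∘ I_{(A,ρ,ρ⁺)}`. -/
def Topt (S : Signature) {A : Type} [SAlg S A] (ρ ρplus : Set (A × A)) :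
    Set (A × A × A × A) :=
  bComp (idBridge ρ ρplus)
    (bComp (deltaFlat S ρplus (centralizer S ρ ρplus)) (idBridge ρ ρplus))

/-- `A` is subdirectly irreducible with monolith `μ`. -/
def IsMonolith (S : Signature) {A : Type} [SAlg S A] (μ : Set (A × A)) : Prop :=
  IsCongruence S μ ∧ μ ≠ diag A ∧ ∀ θ, IsCongruence S θ → θ ≠ diag A → μ ⊆ θ

/-- The carrier of `D(A,θ)`-style quotients: `A(μ)/Δ_{μ,α}`. -/
abbrev DCar (S : Signature) (A : Type) [SAlg S A] (μ α : Set (A × A)) : Type :=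
  Quot (fun p q : ↥μ => ((p : A × A), (q : A × A)) ∈ DeltaCon S μ α)

/-- The class of a pair `p ∈ μ` in `A(μ)/Δ_{μ,α}`. -/
def DCar.mk (S : Signature) (A : Type) [SAlg S A] (μ α : Set (A × A)) (p : ↥μ) :
    DCar S A μ α :=
  Quot.mk _ p

/-- The algebra structure on `A(μ)/Δ_{μ,α}` (extensionally correct when `μ` is a
congruence and `Δ_{μ,α}` is a congruence of `A(μ)`). -/
noncomputable def DAlg (S : Signature) (A : Type) [SAlg S A] (μ α : Set (A × A))
    (h : IsSubuniverse S μ) : SAlg S (DCar S A μ α) :=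
  letI := subAlg μ h
  ⟨fun o x => DCar.mk S A μ α
    (SAlg.interp o fun i => Classical.choose (Quot.exists_rep (x i)))⟩

/-- The canonical similarity bridge `T_{D(A)}` from `A` to `D(A)`. -/
def TDBridge (S : Signature) (A : Type) [SAlg S A] (μ α : Set (A × A)) :
    Set (A × A × DCar S A μ α × DCar S A μ α) :=
  {x | ∃ (a b e : A) (_ : (a, b) ∈ μ) (h1 : (a, e) ∈ μ) (h2 : (b, e) ∈ μ),
    x = (a, b, DCar.mk S A μ α ⟨(a, e), h1⟩, DCar.mk S A μ α ⟨(b, e), h2⟩)}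

/-- Similarity of (subdirectly irreducible) algebras: `D(A) ≅ D(B)`, where `D(X)` is
`X(μ)/Δ_{μ,(0:μ)}` if the monolith `μ` is abelian, and `X` itself otherwise. -/
def SimilarI (S : Signature) {A B : Type} (iA : SAlg S A) (iB : SAlg S B) : Prop :=
  letI := iA
  letI := iB
  ∃ (μA : Set (A × A)) (μB : Set (B × B)) (hA : IsMonolith S μA) (hB : IsMonolith S μB),
    ((Centralizes S μA μA (diag A) ∧ Centralizes S μB μB (diag B)) →
      IsoAlgI (DAlg S A μA (centralizer S (diag A) μA) hA.1.1)
        (DAlg S B μB (centralizer S (diag B) μB) hB.1.1)) ∧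
    ((Centralizes S μA μA (diag A) ∧ ¬ Centralizes S μB μB (diag B)) →
      IsoAlgI (DAlg S A μA (centralizer S (diag A) μA) hA.1.1) iB) ∧
    ((¬ Centralizes S μA μA (diag A) ∧ Centralizes S μB μB (diag B)) →
      IsoAlgI iA (DAlg S B μB (centralizer S (diag B) μB) hB.1.1)) ∧
    ((¬ Centralizes S μA μA (diag A) ∧ ¬ Centralizes S μB μB (diag B)) →
      IsoAlgI iA iB)

end Zhuk

namespace Zhuk

/-- The functions `X → A` generated by the family `G` and the constants under the operations
of `A`: polynomial functions in the "variables" `G`. -/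
inductive IsPol (S : Signature) {A X : Type} [SAlg S A] (G : Set (X → A)) : (X → A) → Prop
  | gen (g : X → A) : g ∈ G → IsPol S G g
  | const (a : A) : IsPol S G fun _ => a
  | app (o : S.ops) (F : Fin (S.arity o) → X → A) : (∀ i, IsPol S G (F i)) →
      IsPol S G fun x => SAlg.interp o fun i => F i x

/-- Unary polynomials. -/
def IsPol₁ (S : Signature) {A : Type} [SAlg S A] (f : A → A) : Prop :=
  IsPol S {id} f

/-- Binary polynomials. -/
def IsPol₂ (S : Signature) {A : Type} [SAlg S A] (q : A → A → A) : Prop :=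
  IsPol S {Prod.fst, Prod.snd} fun x : A × A => q x.1 x.2

/-- Polynomials in one distinguished variable and `n` further ones. -/
def IsPolN (S : Signature) {A : Type} [SAlg S A] {n : ℕ} (t : A → (Fin n → A) → A) : Prop :=
  IsPol S (insert Prod.fst (Set.range fun i (x : A × (Fin n → A)) => x.2 i))
    fun x => t x.1 x.2

section Polynomials

variable {S : Signature} {A X Y : Type} [SAlg S A] {G : Set (X → A)}

theorem IsPol.subst {G' : Set (Y → A)} {F : X → A} (hF : IsPol S G F) (φ : Y → X)
    (hφ : ∀ g ∈ G, IsPol S G' fun y => g (φ y)) : IsPol S G' fun y => F (φ y) := by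
  induction hF with
  | gen g hg => exact hφ g hg
  | const a => exact .const a
  | app o F _ ih => exact .app o (fun i y => F i (φ y)) ih

theorem IsPol.comp₁ {f : A → A} (hf : IsPol₁ S f) {F : X → A} (hF : IsPol S G F) :
    IsPol S G fun x => f (F x) :=
  IsPol.subst hf F (by rintro g rfl; exact hF)

theorem IsPol.comp₂ {q : A → A → A} (hq : IsPol₂ S q) {F₁ F₂ : X → A} (h₁ : IsPol S G F₁)
    (h₂ : IsPol S G F₂) : IsPol S G fun x => q (F₁ x) (F₂ x) :=
  IsPol.subst hq (fun x => (F₁ x, F₂ x)) (by rintro g (rfl | rfl); exacts [h₁, h₂])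

theorem IsPol.compN {n : ℕ} {t : A → (Fin n → A) → A} (ht : IsPolN S t) {F : X → A}
    {W : X → Fin n → A} (hF : IsPol S G F) (hW : ∀ i, IsPol S G fun x => W x i) :
    IsPol S G fun x => t (F x) (W x) :=
  IsPol.subst ht (fun x => (F x, W x)) (by rintro g (rfl | ⟨i, rfl⟩); exacts [hF, hW i])

theorem IsPol.iterate {q : A → A → A} (hq : IsPol₂ S q) {F H : X → A} (hF : IsPol S G F)
    (hH : IsPol S G H) (m : ℕ) : IsPol S G fun x => (q (F x))^[m] (H x) := by
  induction m with
  | zero => exact hH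
  | succ m ih =>
    simp only [Function.iterate_succ_apply']
    exact IsPol.comp₂ hq hF ih

theorem IsPol₁.id : IsPol₁ S (id : A → A) := .gen _ rfl

theorem IsPol₁.comp {f g : A → A} (hf : IsPol₁ S f) (hg : IsPol₁ S g) :
    IsPol₁ S fun x => f (g x) := IsPol.comp₁ hf hg

theorem IsPol₁.iterate {f : A → A} (hf : IsPol₁ S f) (m : ℕ) : IsPol₁ S f^[m] := by
  induction m with
  | zero => exact IsPol₁.id
  | succ m ih =>
    rw [Function.iterate_succ']
    exact hf.comp ih

theorem IsPol₂.fst : IsPol S ({Prod.fst, Prod.snd} : Set (A × A → A)) fun x => x.1 :=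
  .gen _ (Or.inl rfl)

theorem IsPol₂.snd : IsPol S ({Prod.fst, Prod.snd} : Set (A × A → A)) fun x => x.2 :=
  .gen _ (Or.inr rfl)

theorem IsPol₂.left {q : A → A → A} (hq : IsPol₂ S q) (b : A) : IsPol₁ S fun x => q x b :=
  IsPol.comp₂ hq IsPol₁.id (.const b)

theorem IsPol₂.right {q : A → A → A} (hq : IsPol₂ S q) (a : A) : IsPol₁ S (q a) :=
  IsPol.comp₂ hq (.const a) IsPol₁.id

theorem IsPol₂.swap {q : A → A → A} (hq : IsPol₂ S q) : IsPol₂ S fun x y => q y x :=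
  IsPol.comp₂ hq IsPol₂.snd IsPol₂.fst

theorem IsPol.update {n : ℕ} (w : Fin n → A) (i : Fin n) {F : X → A} (hF : IsPol S G F)
    (j : Fin n) : IsPol S G fun x => Function.update w i (F x) j := by
  by_cases h : j = i
  · subst h; simpa using hF
  · simpa [Function.update_of_ne h] using IsPol.const (w j)

theorem IsPolN.slice {n : ℕ} {t : A → (Fin n → A) → A} (ht : IsPolN S t) (w : Fin n → A) :
    IsPol₁ S fun x => t x w :=
  IsPol.compN ht IsPol₁.id fun i => .const (w i)

theorem IsPolN.update {n : ℕ} {t : A → (Fin n → A) → A} (ht : IsPolN S t) (w : Fin n → A)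
    (i : Fin n) {p : A → A} (hp : IsPol₁ S p) :
    IsPol₂ S fun x z => t x (Function.update w i (p z)) :=
  IsPol.compN ht IsPol₂.fst (IsPol.update w i (IsPol.comp₁ hp IsPol₂.snd))

theorem IsPolN.comp₁ {n : ℕ} {t : A → (Fin n → A) → A} (ht : IsPolN S t) {f : A → A}
    (hf : IsPol₁ S f) : IsPolN S fun x w => f (t x w) :=
  IsPol.comp₁ hf ht

theorem STerm.isPol_eval {n : ℕ} (t : STerm S n) (F : X → Fin n → A)
    (hF : ∀ i, IsPol S G fun x => F x i) : IsPol S G fun x => t.eval (F x) := by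
  induction t with
  | var i => exact hF i
  | app o ts ih => exact .app o (fun i x => (ts i).eval (F x)) ih

theorem STerm.isPolN_eval {n : ℕ} (t : STerm S (n + 1)) :
    IsPolN S fun (x : A) (w : Fin n → A) => t.eval (Fin.cons x w) := by
  refine t.isPol_eval (fun x : A × (Fin n → A) => (Fin.cons x.1 x.2 : Fin (n + 1) → A)) ?_
  intro i
  refine Fin.cases ?_ (fun j => ?_) i
  · exact .gen _ (Or.inl rfl)
  · exact .gen _ (Or.inr ⟨j, rfl⟩)

theorem IsPol.pres {F : X → A} (hF : IsPol S G F) {R : Set (A × A)} (hR : IsSubuniverse S R)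
    (hc : ∀ k, (k, k) ∈ R) {x y : X} (hG : ∀ g ∈ G, (g x, g y) ∈ R) : (F x, F y) ∈ R := by
  induction hF with
  | gen g hg => exact hG g hg
  | const a => exact hc a
  | app o F _ ih => exact hR o (fun i => (F i x, F i y)) ih

theorem IsPol.pres₄ {F : X → A} (hF : IsPol S G F) {R : Set (A × A × A × A)}
    (hR : IsSubuniverse S R) (hc : ∀ k, (k, k, k, k) ∈ R) {x₁ x₂ x₃ x₄ : X}
    (hG : ∀ g ∈ G, (g x₁, g x₂, g x₃, g x₄) ∈ R) : (F x₁, F x₂, F x₃, F x₄) ∈ R := by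
  induction hF with
  | gen g hg => exact hG g hg
  | const a => exact hc a
  | app o F _ ih => exact hR o (fun i => (F i x₁, F i x₂, F i x₃, F i x₄)) ih

theorem IsCongruence.pol₁ {μ : Set (A × A)} (hμ : IsCongruence S μ) {f : A → A}
    (hf : IsPol₁ S f) {a b : A} (h : (a, b) ∈ μ) : (f a, f b) ∈ μ :=
  IsPol.pres hf hμ.1 hμ.2.refl (by rintro g rfl; exact h)

theorem IsCongruence.polN {μ : Set (A × A)} (hμ : IsCongruence S μ) {n : ℕ}
    {t : A → (Fin n → A) → A} (ht : IsPolN S t) (a : A) {c d : Fin n → A}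
    (h : ∀ i, (c i, d i) ∈ μ) : (t a c, t a d) ∈ μ :=
  IsPol.pres (x := (a, c)) (y := (a, d)) ht hμ.1 hμ.2.refl
    (by rintro g (rfl | ⟨i, rfl⟩); exacts [hμ.2.refl a, h i])

/-- A property of tuples that survives changing one coordinate along `r` survives changing all
coordinates along `r`. -/
theorem forall_update {n : ℕ} {r : A → A → Prop} {P : (Fin n → A) → Prop}
    (hstep : ∀ w i z, r (w i) z → P w → P (Function.update w i z)) {c d : Fin n → A}
    (h : ∀ i, r (c i) (d i)) (hc : P c) : P d := by
  classical
  have key : ∀ s : Finset (Fin n), P fun i => if i ∈ s then d i else c i := by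
    intro s
    induction s using Finset.induction_on with
    | empty => simpa using hc
    | insert j s hj ih =>
      have := hstep _ j (d j) (by simpa [hj] using h j) ih
      convert this using 1
      funext i
      by_cases hij : i = j
      · subst hij; simp
      · simp [hij]
  simpa using key Finset.univ

theorem forall_update_reflTransGen {n : ℕ} {r : A → A → Prop} {P : (Fin n → A) → Prop}
    (hstep : ∀ w i z, r (w i) z → P w → P (Function.update w i z)) {c d : Fin n → A}
    (h : ∀ i, Relation.ReflTransGen r (c i) (d i)) (hc : P c) : P d := by
  refine forall_update (r := Relation.ReflTransGen r) ?_ h hc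
  intro w i z hz hw
  induction hz with
  | refl => simpa using hw
  | tail _ hyz ih =>
    have := hstep _ i _ (by simpa using hyz) ih
    simpa using this

/-- An equivalence relation preserved by the unary polynomials is a congruence. -/
theorem isCongruence_of_isPol₁ {r : A → A → Prop} (hr : Equivalence r)
    (h : ∀ f, IsPol₁ S f → ∀ a b, r a b → r (f a) (f b)) :
    IsCongruence S {p : A × A | r p.1 p.2} := by
  refine ⟨fun o x hx => ?_, hr⟩
  refine forall_update (r := r)
    (P := fun w => r (SAlg.interp o fun i => (x i).1) (SAlg.interp o w)) ?_ hx (hr.refl _)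
  intro w i z hz hw
  refine hr.trans hw ?_
  have hp : IsPol₁ S fun y => SAlg.interp o (Function.update w i y) :=
    .app o _ fun j => IsPol.update w i IsPol₁.id j
  simpa using h _ hp _ _ hz

/-- `x` and `y` are the images of `u` and `v`, in some order, under a unary polynomial. -/
def PolStep (S : Signature) {A : Type} [SAlg S A] (u v x y : A) : Prop :=
  ∃ p : A → A, IsPol₁ S p ∧ (x = p u ∧ y = p v ∨ x = p v ∧ y = p u)

theorem PolStep.symm {u v x y : A} (h : PolStep S u v x y) : PolStep S u v y x := by
  obtain ⟨p, hp, h | h⟩ := h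
  exacts [⟨p, hp, Or.inr h.symm⟩, ⟨p, hp, Or.inl h.symm⟩]

theorem isCongruence_polStep (u v : A) :
    IsCongruence S {p : A × A | Relation.ReflTransGen (PolStep S u v) p.1 p.2} := by
  refine isCongruence_of_isPol₁ ⟨fun _ => .refl, ?_, .trans⟩ ?_
  · intro x y h
    induction h with
    | refl => exact .refl
    | tail _ hyz ih => exact .head hyz.symm ih
  · intro f hf a b h
    refine Relation.ReflTransGen.lift f ?_ _ _ h
    rintro x y ⟨p, hp, ⟨rfl, rfl⟩ | ⟨rfl, rfl⟩⟩
    exacts [⟨_, hf.comp hp, Or.inl ⟨rfl, rfl⟩⟩, ⟨_, hf.comp hp, Or.inr ⟨rfl, rfl⟩⟩]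

end Polynomials

/-- On a finite set, some positive power is the identity for all permutations at once. -/
theorem exists_iterate_eq_self {A : Type} [Finite A] (U : Set A) :
    ∃ m : ℕ, ∀ h : A → A, Set.MapsTo h U U → Set.InjOn h U → ∀ x ∈ U, h^[m + 1] x = x := by
  obtain ⟨m, hm⟩ : ∃ m, Nat.card (Equiv.Perm U) = m + 1 :=
    ⟨_, (Nat.succ_pred_eq_of_pos Nat.card_pos).symm⟩
  refine ⟨m, fun h hU hinj x hx => ?_⟩
  let s : Equiv.Perm U := Equiv.ofBijective (hU.restrict h U U)
    (Finite.injective_iff_bijective.1 (hU.restrict_inj.2 hinj))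
  have hs : s ^ (m + 1) = 1 := hm ▸ pow_card_eq_one'
  have hk : ∀ k : ℕ, (((s ^ k) ⟨x, hx⟩ : U) : A) = h^[k] x := by
    intro k
    induction k with
    | zero => rfl
    | succ k ih => rw [pow_succ', Equiv.Perm.mul_apply, Function.iterate_succ_apply', ← ih]; rfl
  rw [← hk, hs]; rfl

/-- A set `U` behaving like a minimal set for the congruence `μ`, with a pair `(u, v)` in
`μ|_U` which generates `μ` and along which the term condition holds. -/
structure MinimalPair (S : Signature) {A : Type} [SAlg S A] (μ : Set (A × A)) (U : Set A)
    (u v : A) : Prop where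
  cong : IsCongruence S μ
  injOn : ∀ f, IsPol₁ S f → ∀ c ∈ U, ∀ d ∈ U, (c, d) ∈ μ → f c ≠ f d → Set.InjOn f U
  left_mem : u ∈ U
  right_mem : v ∈ U
  mem : (u, v) ∈ μ
  ne : u ≠ v
  link : ∀ a b, (a, b) ∈ μ → Relation.ReflTransGen (PolStep S u v) a b
  term : ∀ q, IsPol₂ S q → ∀ a b, (a, b) ∈ μ → q a u = q a v → q b u = q b v

namespace MinimalPair

variable {S : Signature} {A : Type} [SAlg S A] {μ : Set (A × A)} {U : Set A} {u v : A}

theorem step_mem (h : MinimalPair S μ U u v) {x y : A} (hxy : PolStep S u v x y) :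
    (x, y) ∈ μ := by
  obtain ⟨p, hp, ⟨rfl, rfl⟩ | ⟨rfl, rfl⟩⟩ := hxy
  exacts [h.cong.pol₁ hp h.mem, h.cong.pol₁ hp (h.cong.2.symm h.mem)]

theorem injOn_transfer (h : MinimalPair S μ U u v) {q : A → A → A} (hq : IsPol₂ S q) {a b : A}
    (hab : (a, b) ∈ μ) (hinj : Set.InjOn (q a) U) : Set.InjOn (q b) U := by
  refine h.injOn _ (hq.right b) u h.left_mem v h.right_mem h.mem fun hb => h.ne ?_
  exact hinj h.left_mem h.right_mem (h.term q hq b a (h.cong.2.symm hab) hb)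

theorem injOn_slice (h : MinimalPair S μ U u v) {n : ℕ} {t : A → (Fin n → A) → A}
    (ht : IsPolN S t) {c d : Fin n → A} (hcd : ∀ i, (c i, d i) ∈ μ)
    (hinj : Set.InjOn (fun x => t x c) U) : Set.InjOn (fun x => t x d) U := by
  refine forall_update (r := fun x y => (x, y) ∈ μ)
    (P := fun w => Set.InjOn (fun x => t x w) U) ?_ hcd hinj
  intro w i z hz hw
  have hq : IsPol₂ S fun z x => t x (Function.update w i z) :=
    (ht.update w i IsPol₁.id).swap
  exact h.injOn_transfer hq hz (by simpa using hw)

/-- A Maltsev polynomial on the trace of `u`, built from a binary polynomial which is injective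
in both variables. -/
theorem exists_maltsev [Finite A] (h : MinimalPair S μ U u v) {q : A → A → A}
    (hq : IsPol₂ S q) (hqU : ∀ x y, q x y ∈ U) (hqu : Set.InjOn (fun x => q x u) U) {b : A}
    (hub : (u, b) ∈ μ) (hqb : q b u ≠ q b v) :
    ∃ D : A → A → A → A,
      (∀ {X : Type} {G : Set (X → A)} {F₁ F₂ F₃ : X → A}, IsPol S G F₁ → IsPol S G F₂ →
        IsPol S G F₃ → IsPol S G fun x => D (F₁ x) (F₂ x) (F₃ x)) ∧
      (∀ x ∈ U, ∀ z ∈ U, (u, x) ∈ μ → (u, z) ∈ μ → D x x z = z) ∧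
      (∀ x ∈ U, ∀ y ∈ U, (u, x) ∈ μ → (u, y) ∈ μ → D x y y = x) ∧
      (∀ x ∈ U, ∀ y ∈ U, ∀ z ∈ U, (u, x) ∈ μ → (u, y) ∈ μ → (u, z) ∈ μ →
        D x y z = D y y z → x = y) := by
  obtain ⟨k, hk⟩ := exists_iterate_eq_self U
  have hπU : Set.MapsTo (fun x => q x u) U U := fun x _ => hqU x u
  set r : A → A → A := fun x y => (fun x => q x u)^[k] (q x y) with hr
  have hrP : IsPol₂ S r := IsPol.comp₁ ((hq.left u).iterate k) hq
  have hrU : ∀ x y, r x y ∈ U := fun x y => hπU.iterate k (hqU x y)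
  have hru : ∀ x ∈ U, r x u = x := fun x hx => by
    have := hk _ hπU hqu x hx
    rwa [Function.iterate_succ_apply] at this
  have hrb : r b u ≠ r b v := fun hh => hqb (hqu.iterate hπU k (hqU _ _) (hqU _ _) hh)
  have hright : ∀ x, (u, x) ∈ μ → Set.InjOn (r x) U := fun x hx =>
    h.injOn_transfer hrP (h.cong.2.trans (h.cong.2.symm hub) hx)
      (h.injOn _ (hrP.right b) u h.left_mem v h.right_mem h.mem hrb)
  have hleft : ∀ y, (u, y) ∈ μ → Set.InjOn (fun x => r x y) U := fun y hy =>
    h.injOn_transfer hrP.swap hy fun x hx x' hx' hh => by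
      simpa [hru x hx, hru x' hx'] using hh
  let N : Set A := {x | x ∈ U ∧ (u, x) ∈ μ}
  have hrN : ∀ x ∈ N, Set.MapsTo (r x) N N := fun x hx y hy => by
    refine ⟨hrU x y, h.cong.2.trans hx.2 ?_⟩
    have := h.cong.pol₁ (hrP.right x) hy.2
    rwa [hru x hx.1] at this
  have huN : u ∈ N := ⟨h.left_mem, h.cong.2.refl u⟩
  obtain ⟨m, hm⟩ := exists_iterate_eq_self N
  have hdiv : ∀ y ∈ N, ∀ z ∈ N, r y ((r y)^[m] z) = z := fun y hy z hz => by
    rw [← Function.iterate_succ_apply' (r y)]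
    exact hm _ (hrN y hy) ((hright y hy.2).mono fun _ hx => hx.1) z hz
  refine ⟨fun x y z => r x ((r y)^[m] z), ?_, ?_, ?_, ?_⟩
  · intro X G F₁ F₂ F₃ h₁ h₂ h₃
    exact IsPol.comp₂ hrP h₁ (IsPol.iterate hrP h₂ h₃ m)
  · intro x hx z hz hx' hz'
    exact hdiv x ⟨hx, hx'⟩ z ⟨hz, hz'⟩
  · intro x hx y hy hx' hy'
    have : (r y)^[m] y = u := by
      have := hm _ (hrN y ⟨hy, hy'⟩) ((hright y hy').mono fun _ hx => hx.1) u huN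
      rwa [Function.iterate_succ_apply, hru y hy] at this
    simp only [this, hru x hx]
  · intro x hx y hy z hz hx' hy' hz' hh
    exact hleft _ ((hrN y ⟨hy, hy'⟩).iterate m (show z ∈ N from ⟨hz, hz'⟩)).2 hx hy hh

theorem term_condition_normalized [Finite A] (h : MinimalPair S μ U u v) {n : ℕ}
    {t : A → (Fin n → A) → A} (ht : IsPolN S t) (htU : ∀ x w, t x w ∈ U) {c d : Fin n → A}
    (hcd : ∀ i, (c i, d i) ∈ μ) (htc : ∀ x ∈ U, t x c = x) {a b : A} (ha : a ∈ U) (hb : b ∈ U)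
    (hua : (u, a) ∈ μ) (hub : (u, b) ∈ μ) (had : t a d = a) : t b d = b := by
  by_contra hbd
  have hlink : ∀ i, Relation.ReflTransGen (PolStep S u v) (c i) (d i) :=
    fun i => h.link _ _ (hcd i)
  have hclass : ∀ (w : Fin n → A) (i : Fin n) (z : A), PolStep S u v (w i) z →
      (∀ j, (c j, w j) ∈ μ) → ∀ j, (c j, Function.update w i z j) ∈ μ := by
    intro w i z hz hw j
    by_cases hj : j = i
    · subst hj
      simpa using h.cong.2.trans (hw j) (h.step_mem hz)
    · simpa [hj] using hw j
  obtain ⟨w, i, z, hz, hw, hne⟩ : ∃ w i z, PolStep S u v (w i) z ∧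
      (∀ j, (c j, w j) ∈ μ) ∧ t b w ≠ t b (Function.update w i z) := by
    by_contra! hcon
    refine hbd (forall_update_reflTransGen
      (P := fun w => (∀ j, (c j, w j) ∈ μ) ∧ t b w = b) ?_ hlink
      ⟨fun j => h.cong.2.refl _, htc b hb⟩).2
    intro w i z hz hw
    exact ⟨hclass w i z hz hw.1, (hcon w i z hz hw.1).symm.trans hw.2⟩
  obtain ⟨p, hp, hpz⟩ := hz
  have hpu : (w i, p u) ∈ μ := by
    obtain ⟨hw', -⟩ | ⟨hw', -⟩ := hpz
    · rw [hw']; exact h.cong.2.refl _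
    · rw [hw']; exact h.cong.pol₁ hp (h.cong.2.symm h.mem)
  have hqu : Set.InjOn (fun x => t x (Function.update w i (p u))) U := by
    refine h.injOn_slice ht (c := c) (fun j => ?_) ?_
    · by_cases hj : j = i
      · subst hj; simpa using h.cong.2.trans (hw j) hpu
      · simpa [hj] using hw j
    · intro x hx y hy hxy
      simpa [htc x hx, htc y hy] using hxy
  have hqb : t b (Function.update w i (p u)) ≠ t b (Function.update w i (p v)) := by
    obtain ⟨h₁, h₂⟩ | ⟨h₁, h₂⟩ := hpz
    · rw [← h₁, ← h₂, Function.update_eq_self]; exact hne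
    · rw [← h₁, ← h₂, Function.update_eq_self]; exact hne.symm
  obtain ⟨D, hD, hD₁, hD₂, hD₃⟩ :=
    h.exists_maltsev (ht.update w i hp) (fun x y => htU _ _) hqu hub hqb
  have htμ : ∀ x ∈ U, (u, x) ∈ μ → ∀ w : Fin n → A, (∀ j, (c j, w j) ∈ μ) → (u, t x w) ∈ μ := by
    intro x hx hux w hw
    have := h.cong.polN ht x hw
    rw [htc x hx] at this
    exact h.cong.2.trans hux this
  have hH : D (t b d) (t b d) (t a d) = D (t b d) (t b c) (t a c) := by
    refine (forall_update_reflTransGen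
      (P := fun w => (∀ j, (c j, w j) ∈ μ) ∧
        D (t b d) (t b w) (t a w) = D (t b d) (t b c) (t a c)) ?_ hlink
      ⟨fun j => h.cong.2.refl _, rfl⟩).2
    intro w i z hz hw
    refine ⟨hclass w i z hz hw.1, Eq.trans ?_ hw.2⟩
    have hcl := hclass w i z hz hw.1
    have hEqW : D (t a d) (t a w) (t a w) = t a d :=
      hD₂ _ (htU _ _) _ (htU _ _) (htμ a ha hua d hcd) (htμ a ha hua w hw.1)
    have hEqZ : D (t a d) (t a (Function.update w i z)) (t a (Function.update w i z)) = t a d :=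
      hD₂ _ (htU _ _) _ (htU _ _) (htμ a ha hua d hcd) (htμ a ha hua _ hcl)
    obtain ⟨p, hp, hpz⟩ := hz
    have hq : IsPol₂ S fun x y => D (t x d) (t x (Function.update w i (p y)))
        (t a (Function.update w i (p y))) :=
      hD (IsPol.comp₁ (ht.slice d) IsPol₂.fst) (ht.update w i hp)
        (IsPol.comp₁ ((ht.update w i hp).right a) IsPol₂.snd)
    have hab : (a, b) ∈ μ := h.cong.2.trans (h.cong.2.symm hua) hub
    have hT := h.term _ hq a b hab
    obtain ⟨h₁, h₂⟩ | ⟨h₁, h₂⟩ := hpz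
    · simp only [← h₁, ← h₂, Function.update_eq_self] at hT
      exact (hT (hEqW.trans hEqZ.symm)).symm
    · simp only [← h₁, ← h₂, Function.update_eq_self] at hT
      exact hT (hEqZ.trans hEqW.symm)
  rw [htc b hb, htc a ha, had, hD₁ _ (htU _ _) _ ha (htμ b hb hub d hcd) hua] at hH
  refine hbd (hD₃ _ (htU b d) _ hb _ ha (htμ b hb hub d hcd) hub hua ?_)
  rw [← hH, hD₁ _ hb _ ha hub hua]

theorem term_condition_trace [Finite A] (h : MinimalPair S μ U u v) {n : ℕ}
    {t : A → (Fin n → A) → A} (ht : IsPolN S t) (htU : ∀ x w, t x w ∈ U) {c d : Fin n → A}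
    (hcd : ∀ i, (c i, d i) ∈ μ) {a b : A} (ha : a ∈ U) (hb : b ∈ U)
    (hua : (u, a) ∈ μ) (hub : (u, b) ∈ μ) (had : t a c = t a d) : t b c = t b d := by
  have hab : (a, b) ∈ μ := h.cong.2.trans (h.cong.2.symm hua) hub
  by_cases hinj : Set.InjOn (fun x => t x c) U
  · obtain ⟨k, hk⟩ := exists_iterate_eq_self U
    have hU : Set.MapsTo (fun x => t x c) U U := fun x _ => htU x c
    have hid : ∀ x ∈ U, (fun x => t x c)^[k] (t x c) = x := fun x hx => by
      have := hk _ hU hinj x hx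
      rwa [Function.iterate_succ_apply] at this
    have := h.term_condition_normalized (ht.comp₁ ((ht.slice c).iterate k))
      (fun x w => hU.iterate k (htU x w)) hcd hid ha hb hua hub (by rw [← had, hid a ha])
    exact hinj.iterate hU k (htU _ _) (htU _ _) ((hid b hb).trans this.symm)
  · have hc : t a c = t b c := by
      by_contra hne
      exact hinj (h.injOn _ (ht.slice c) a ha b hb hab hne)
    have hd : t a d = t b d := by
      by_contra hne
      exact hinj (h.injOn_slice ht (fun i => h.cong.2.symm (hcd i))
        (h.injOn _ (ht.slice d) a ha b hb hab hne))
    rw [← hc, had, hd]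

theorem term_condition [Finite A] (h : MinimalPair S μ U u v) {n : ℕ}
    {t : A → (Fin n → A) → A} (ht : IsPolN S t) (htU : ∀ x w, t x w ∈ U) {c d : Fin n → A}
    (hcd : ∀ i, (c i, d i) ∈ μ) {a b : A} (hab : (a, b) ∈ μ) (had : t a c = t a d) :
    t b c = t b d := by
  have hlink := h.link a b hab
  induction hlink with
  | refl => exact had
  | tail hay hstep ih =>
    rename_i y z
    have hyz := h.step_mem hstep
    have hay' := ih (h.cong.2.trans hab (h.cong.2.symm hyz))
    obtain ⟨p, hp, hpz⟩ := hstep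
    have htp : IsPolN S fun x w => t (p x) w :=
      IsPol.compN ht (IsPol.comp₁ hp (.gen _ (Or.inl rfl))) fun i => .gen _ (Or.inr ⟨i, rfl⟩)
    have hu := h.cong.2.refl u
    obtain ⟨rfl, rfl⟩ | ⟨rfl, rfl⟩ := hpz
    · exact h.term_condition_trace htp (fun x w => htU _ _) hcd h.left_mem h.right_mem hu h.mem
        hay'
    · exact h.term_condition_trace htp (fun x w => htU _ _) hcd h.right_mem h.left_mem h.mem hu
        hay'

end MinimalPair

section Monolith

variable {S : Signature} {A : Type} [SAlg S A] {μ : Set (A × A)}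

/-- Polynomials followed by `f` separate points, if `f` does not collapse the monolith. -/
theorem exists_separating (hmin : ∀ θ, IsCongruence S θ → θ ≠ diag A → μ ⊆ θ) {f : A → A}
    (hf : ∃ x y, (x, y) ∈ μ ∧ f x ≠ f y) {x y : A} (hxy : x ≠ y) :
    ∃ g, IsPol₁ S g ∧ f (g x) ≠ f (g y) := by
  by_contra! hcon
  obtain ⟨x', y', hμ, hne⟩ := hf
  have hθ : IsCongruence S
      {p : A × A | ∀ g : A → A, IsPol₁ S g → f (g p.1) = f (g p.2)} := by
    refine isCongruence_of_isPol₁ (r := fun x y => ∀ g : A → A, IsPol₁ S g → f (g x) = f (g y))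
      ⟨fun _ _ _ => rfl, fun h g hg => (h g hg).symm,
        fun h h' g hg => (h g hg).trans (h' g hg)⟩ ?_
    intro p hp a b h g hg
    exact h _ (hg.comp hp)
  have hd : {p : A × A | ∀ g : A → A, IsPol₁ S g → f (g p.1) = f (g p.2)} ≠ diag A := by
    intro h
    have : (x, y) ∈ diag A := h ▸ hcon
    exact hxy this
  exact hne (hmin _ hθ hd hμ id IsPol₁.id)

theorem exists_minimal_idempotent [Finite A] (hμ : IsCongruence S μ)
    (hmin : ∀ θ, IsCongruence S θ → θ ≠ diag A → μ ⊆ θ) (hne : ∃ x y, (x, y) ∈ μ ∧ x ≠ y) :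
    ∃ e : A → A, IsPol₁ S e ∧ (∃ x y, (x, y) ∈ μ ∧ e x ≠ e y) ∧ (∀ x, e (e x) = e x) ∧
      ∀ f, IsPol₁ S f → (∃ x y, (x, y) ∈ μ ∧ f x ≠ f y) → Set.range f ⊆ Set.range e →
        Set.range f = Set.range e := by
  obtain ⟨f, ⟨hf, hfμ⟩, hfmin⟩ := WellFounded.has_min
    (InvImage.wf (fun f : A → A => (Set.range f).ncard) Nat.lt_wfRel.wf)
    {f | IsPol₁ S f ∧ ∃ x y, (x, y) ∈ μ ∧ f x ≠ f y} ⟨id, IsPol₁.id, hne⟩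
  have hrange : ∀ g, IsPol₁ S g → (∃ x y, (x, y) ∈ μ ∧ g x ≠ g y) →
      Set.range g ⊆ Set.range f → Set.range g = Set.range f := fun g hg hgμ hgf =>
    Set.eq_of_subset_of_ncard_le hgf (not_lt.1 (hfmin g ⟨hg, hgμ⟩)) (Set.toFinite _)
  obtain ⟨x, y, hxy, hfxy⟩ := hfμ
  obtain ⟨g, hg, hgxy⟩ := exists_separating hmin ⟨x, y, hxy, hfxy⟩ hfxy
  have hfg : IsPol₁ S fun z => f (g z) := hf.comp hg
  have hrg := hrange _ (hfg.comp hf) ⟨x, y, hxy, hgxy⟩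
    (by rintro _ ⟨z, rfl⟩; exact ⟨_, rfl⟩)
  have hU : Set.MapsTo (fun z => f (g z)) (Set.range f) (Set.range f) :=
    fun z _ => ⟨g z, rfl⟩
  have hinj : Set.InjOn (fun z => f (g z)) (Set.range f) := by
    rw [← Set.ncard_image_iff (Set.toFinite _), ← Set.range_comp]
    exact congrArg Set.ncard hrg
  obtain ⟨k, hk⟩ := exists_iterate_eq_self (Set.range f)
  have hid := hk _ hU hinj
  have hmem : ∀ z, (fun z => f (g z))^[k + 1] z ∈ Set.range f := fun z => by
    rw [Function.iterate_succ_apply']; exact ⟨_, rfl⟩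
  have hre : Set.range (fun z => f (g z))^[k + 1] = Set.range f := by
    refine Set.Subset.antisymm (by rintro _ ⟨z, rfl⟩; exact hmem z) ?_
    rintro _ ⟨z, rfl⟩
    exact ⟨f z, hid _ ⟨z, rfl⟩⟩
  refine ⟨_, hfg.iterate (k + 1), ⟨f x, f y, hμ.pol₁ hf hxy, ?_⟩, fun z => hid _ (hmem z), ?_⟩
  · rwa [hid _ ⟨x, rfl⟩, hid _ ⟨y, rfl⟩]
  · rw [hre]; exact hrange

/-- If a compatible quaternary relation matches the diagonal with the diagonal, relates some
nontrivial pair of the monolith to itself, and has nontrivial trace, then the monolith is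
abelian. -/
theorem centralizes_of_bridge [Finite A] (hμ : IsCongruence S μ)
    (hmin : ∀ θ, IsCongruence S θ → θ ≠ diag A → μ ⊆ θ) {R : Set (A × A × A × A)}
    (hR : IsSubuniverse S R) (hrefl : ∀ k, (k, k, k, k) ∈ R)
    (hdiag : ∀ a b c d, (a, b, c, d) ∈ R → (a = b ↔ c = d))
    {r s : A} (hrs : (r, s) ∈ μ) (hrsne : r ≠ s) (hrsR : (r, s, r, s) ∈ R)
    {x y : A} (hxy : (x, x, y, y) ∈ R) (hxyne : x ≠ y) : Centralizes S μ μ (diag A) := by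
  obtain ⟨e, he, heμ, hee, hemin⟩ := exists_minimal_idempotent hμ hmin ⟨r, s, hrs, hrsne⟩
  obtain ⟨g, hg, hgne⟩ := exists_separating hmin heμ hrsne
  have heg := he.comp hg
  have huvR : (e (g r), e (g s), e (g r), e (g s)) ∈ R :=
    IsPol.pres₄ heg hR hrefl (by rintro _ rfl; exact hrsR)
  have hM : MinimalPair S μ (Set.range e) (e (g r)) (e (g s)) := by
    refine ⟨hμ, ?_, ⟨_, rfl⟩, ⟨_, rfl⟩, hμ.pol₁ heg hrs, hgne, ?_, ?_⟩
    · rintro f hf _ ⟨c, rfl⟩ _ ⟨d, rfl⟩ hcd hne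
      obtain ⟨p, hp, hpne⟩ := exists_separating hmin heμ hne
      have hpf := he.comp (hp.comp hf)
      have hrg := hemin _ (hpf.comp he) ⟨_, _, hcd, by simpa only [hee] using hpne⟩
        (by rintro _ ⟨z, rfl⟩; exact ⟨_, rfl⟩)
      have hinj : Set.InjOn (fun z => e (p (f z))) (Set.range e) := by
        rw [← Set.ncard_image_iff (Set.toFinite _), ← Set.range_comp]
        exact congrArg Set.ncard hrg
      intro a ha b hb hab
      exact hinj ha hb (congrArg (fun z => e (p z)) hab)
    · intro a b hab
      refine hmin _ (isCongruence_polStep (e (g r)) (e (g s))) (fun h => hgne ?_) hab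
      have : (e (g r), e (g s)) ∈ diag A :=
        h ▸ Relation.ReflTransGen.single ⟨id, IsPol₁.id, Or.inl ⟨rfl, rfl⟩⟩
      exact this
    · intro q hq a b hab
      have hφ : IsCongruence S {p : A × A | ∀ q : A → A → A, IsPol₂ S q →
          (q p.1 (e (g r)) = q p.1 (e (g s)) ↔ q p.2 (e (g r)) = q p.2 (e (g s)))} := by
        refine isCongruence_of_isPol₁ (r := fun a b => ∀ q : A → A → A, IsPol₂ S q →
          (q a (e (g r)) = q a (e (g s)) ↔ q b (e (g r)) = q b (e (g s))))
          ⟨fun _ _ _ => Iff.rfl, fun h q hq => (h q hq).symm,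
            fun h h' q hq => (h q hq).trans (h' q hq)⟩ ?_
        intro f hf a b h q hq
        exact h (fun x y => q (f x) y) (IsPol.comp₂ hq (IsPol.comp₁ hf IsPol₂.fst) IsPol₂.snd)
      refine (hmin _ hφ (fun h => hxyne ?_) hab q hq).1
      have hmem : (x, y) ∈ diag A := by
        rw [← h]
        intro q hq
        refine hdiag _ _ _ _ (IsPol.pres₄ (x₁ := (x, e (g r))) (x₂ := (x, e (g s)))
          (x₃ := (y, e (g r))) (x₄ := (y, e (g s))) hq hR hrefl ?_)
        rintro _ (rfl | rfl)
        exacts [hxy, huvR]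
      exact hmem
  intro n t a b c d hab hcd heq
  by_contra hne
  obtain ⟨p, hp, hpne⟩ := exists_separating hmin heμ hne
  exact hpne (hM.term_condition (t.isPolN_eval.comp₁ (he.comp hp)) (fun _ _ => ⟨_, rfl⟩) hcd hab
    (congrArg (fun z => e (p z)) heq))

end Monolith

section Quotient

variable {S : Signature} {A : Type} [iA : SAlg S A] {ρ : Set (A × A)}

theorem ConQuot.mk_eq_iff (hρ : IsCongruence S ρ) {a b : A} :
    ConQuot.mk ρ a = ConQuot.mk ρ b ↔ (a, b) ∈ ρ := by
  refine ⟨fun h => ?_, fun h => Quot.sound h⟩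
  exact (Equivalence.eqvGen_iff hρ.2).1 (Quot.eqvGen_exact h)

theorem ConQuot.mk_surjective : Function.Surjective (ConQuot.mk ρ) := Quot.exists_rep

theorem quotAlg_interp (hρ : IsCongruence S ρ) (o : S.ops) (x : Fin (S.arity o) → A) :
    (quotAlg iA ρ).interp o (fun i => ConQuot.mk ρ (x i)) = ConQuot.mk ρ (SAlg.interp o x) := by
  refine (ConQuot.mk_eq_iff hρ).2 (hρ.1 o (fun i => (_, x i)) fun i => ?_)
  exact (ConQuot.mk_eq_iff hρ).1
    (Classical.choose_spec (Quot.exists_rep (ConQuot.mk ρ (x i))))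

theorem quotAlg_eval (hρ : IsCongruence S ρ) {n : ℕ} (t : STerm S n) (x : Fin n → A) :
    @STerm.eval S _ (quotAlg iA ρ) n t (fun i => ConQuot.mk ρ (x i)) =
      ConQuot.mk ρ (t.eval x) := by
  induction t with
  | var i => rfl
  | app o ts ih =>
    refine Eq.trans ?_ (quotAlg_interp hρ o fun i => (ts i).eval x)
    exact congrArg _ (funext ih)

end Quotient

/-- For a bridge anchored below the nonabelian upper cover of `ρ`, the converse of the trace is
single-valued modulo `ρ`. -/
theorem btr_left_unique {S : Signature} {A B : Type} [iA : SAlg S A] [SAlg S B] [Finite A]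
    {ρ ρplus : Set (A × A)} {σ : Set (B × B)} (hρ : MeetIrredWith S ρ ρplus)
    (hnab : ¬ Centralizes S ρplus ρplus ρ) {T : Set (A × A × B × B)} (hT : IsBridge S ρ σ T)
    (hT' : pr12 T ⊆ ρplus) {a a' : A} {b : B} (ha : (a, b) ∈ btr T) (ha' : (a', b) ∈ btr T) :
    (a, a') ∈ ρ := by
  obtain ⟨hcon, -, hplus, hlt, hmin⟩ := hρ
  obtain ⟨hsub, -, -, hpr, -, hiff⟩ := hT
  by_contra hne
  let : SAlg S (ConQuot ρ) := quotAlg iA ρ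
  have : Finite (ConQuot ρ) := Finite.of_surjective _ ConQuot.mk_surjective
  let mk : A → ConQuot ρ := ConQuot.mk ρ
  have mk_eq : ∀ {a b : A}, mk a = mk b ↔ (a, b) ∈ ρ := ConQuot.mk_eq_iff hcon
  have mk_interp : ∀ (o : S.ops) (x : Fin (S.arity o) → A),
      SAlg.interp o (fun i => mk (x i)) = mk (SAlg.interp o x) := quotAlg_interp hcon
  have mk_eval : ∀ {n : ℕ} (t : STerm S n) (x : Fin n → A),
      t.eval (fun i => mk (x i)) = mk (t.eval x) := quotAlg_eval hcon
  have mk_surj : Function.Surjective mk := ConQuot.mk_surjective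
  let μ : Set (ConQuot ρ × ConQuot ρ) := {p | ∃ x y, (x, y) ∈ ρplus ∧ mk x = p.1 ∧ mk y = p.2}
  have hμmk : ∀ {x y : A}, (mk x, mk y) ∈ μ ↔ (x, y) ∈ ρplus := by
    intro x y
    refine ⟨?_, fun h => ⟨x, y, h, rfl, rfl⟩⟩
    rintro ⟨x', y', h, hx, hy⟩
    exact hplus.2.trans (hlt.1 (mk_eq.1 hx.symm)) (hplus.2.trans h (hlt.1 (mk_eq.1 hy)))
  have hμ : IsCongruence S μ := by
    refine ⟨fun o z hz => ?_, ?_, ?_, ?_⟩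
    · choose x y hxy hx hy using hz
      refine ⟨_, _, hplus.1 o (fun i => (x i, y i)) hxy, ?_, ?_⟩
      · rw [← mk_interp]; exact congrArg (SAlg.interp o) (funext hx)
      · rw [← mk_interp]; exact congrArg (SAlg.interp o) (funext hy)
    · intro x
      obtain ⟨x, rfl⟩ := mk_surj x
      exact hμmk.2 (hplus.2.refl x)
    · rintro _ _ ⟨x, y, h, rfl, rfl⟩
      exact hμmk.2 (hplus.2.symm h)
    · intro x y z
      obtain ⟨x, rfl⟩ := mk_surj x
      obtain ⟨y, rfl⟩ := mk_surj y
      obtain ⟨z, rfl⟩ := mk_surj z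
      simp only [hμmk]
      exact hplus.2.trans
  have hμmin : ∀ θ, IsCongruence S θ → θ ≠ diag (ConQuot ρ) → μ ⊆ θ := by
    intro θ hθ hd
    have hpre : IsCongruence S {p : A × A | (mk p.1, mk p.2) ∈ θ} := by
      refine ⟨fun o z hz => ?_, fun _ => hθ.2.refl _, fun h => hθ.2.symm h,
        fun h h' => hθ.2.trans h h'⟩
      have := hθ.1 o (fun i => (mk (z i).1, mk (z i).2)) hz
      change (SAlg.interp o _, SAlg.interp o _) ∈ θ at this
      rwa [mk_interp, mk_interp] at this
    have hlt' : ρ ⊂ {p : A × A | (mk p.1, mk p.2) ∈ θ} := by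
      refine ⟨fun p hp => ?_, fun hle => hd ?_⟩
      · change (mk p.1, mk p.2) ∈ θ
        rw [mk_eq.2 hp]
        exact hθ.2.refl _
      · ext ⟨x, y⟩
        obtain ⟨x, rfl⟩ := mk_surj x
        obtain ⟨y, rfl⟩ := mk_surj y
        refine ⟨fun h => mk_eq.2 (hle h), fun h => ?_⟩
        change mk x = mk y at h
        rw [h]
        exact hθ.2.refl _
    rintro ⟨_, _⟩ ⟨x, y, hxy, rfl, rfl⟩
    exact hmin _ hpre hlt' hxy
  obtain ⟨⟨r, s⟩, ⟨b₁, b₂, hrs⟩, hrsne⟩ := Set.exists_of_ssubset hpr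
  let R : Set (ConQuot ρ × ConQuot ρ × ConQuot ρ × ConQuot ρ) :=
    {z | ∃ a₁ a₂ a₃ a₄ b₁ b₂, (a₁, a₂, b₁, b₂) ∈ T ∧ (a₃, a₄, b₁, b₂) ∈ T ∧
      (mk a₁, mk a₂, mk a₃, mk a₄) = z}
  have hR : IsSubuniverse S R := by
    intro o z hz
    choose a₁ a₂ a₃ a₄ b₁ b₂ h h' hz using hz
    refine ⟨_, _, _, _, _, _, hsub o (fun i => (a₁ i, a₂ i, b₁ i, b₂ i)) h,
      hsub o (fun i => (a₃ i, a₄ i, b₁ i, b₂ i)) h', ?_⟩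
    obtain rfl : (fun i => (mk (a₁ i), mk (a₂ i), mk (a₃ i), mk (a₄ i))) = z := funext hz
    simp only [← mk_interp]
    rfl
  have habel : Centralizes S μ μ (diag (ConQuot ρ)) := by
    refine centralizes_of_bridge (R := R) hμ hμmin hR ?_ ?_
      (hμmk.2 (hT' ⟨b₁, b₂, hrs⟩)) (fun h => hrsne (mk_eq.1 h)) ⟨_, _, _, _, _, _, hrs, hrs, rfl⟩
      ⟨_, _, _, _, _, _, ha, ha', rfl⟩ (fun h => hne (mk_eq.1 h))
    · intro k
      obtain ⟨k, rfl⟩ := mk_surj k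
      obtain ⟨b₁, b₂, hb⟩ := hpr.1 (hcon.2.refl k)
      exact ⟨_, _, _, _, _, _, hb, hb, rfl⟩
    · rintro _ _ _ _ ⟨a₁, a₂, a₃, a₄, b₁, b₂, h, h', hz⟩
      simp only [Prod.mk.injEq] at hz
      obtain ⟨rfl, rfl, rfl, rfl⟩ := hz
      rw [mk_eq, mk_eq, hiff _ _ _ _ h, hiff _ _ _ _ h']
  refine hnab fun n t a b c d hab hcd heq => ?_
  have mk_cons : ∀ (x : A) (w : Fin n → A),
      t.eval (Fin.cons (mk x) fun i => mk (w i) : Fin (n + 1) → ConQuot ρ) =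
        mk (t.eval (Fin.cons x w)) := by
    intro x w
    rw [← mk_eval]
    refine congrArg t.eval (funext fun i => ?_)
    refine Fin.cases ?_ (fun j => ?_) i <;> rfl
  have := habel n t (mk a) (mk b) (fun i => mk (c i)) (fun i => mk (d i)) (hμmk.2 hab)
    (fun i => hμmk.2 (hcd i))
  rw [mk_cons, mk_cons, mk_cons, mk_cons] at this
  exact mk_eq.1 (this (mk_eq.2 heq))

theorem IsBridge.conv {S : Signature} {A B : Type} [SAlg S A] [SAlg S B] {ρ : Set (A × A)}
    {σ : Set (B × B)} {T : Set (A × A × B × B)} (hT : IsBridge S ρ σ T) :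
    IsBridge S σ ρ (bConv T) := by
  obtain ⟨hsub, hl, hr, hρ, hσ, hiff⟩ := hT
  refine ⟨fun o x hx => hsub o (fun i => ((x i).2.2.1, (x i).2.2.2, (x i).1, (x i).2.1)) hx,
    fun _ _ _ _ _ _ h => hr _ _ _ _ _ _ h, fun _ _ _ _ _ _ h => hl _ _ _ _ _ _ h,
    hσ, hρ, fun _ _ _ _ h => (hiff _ _ _ _ h).symm⟩

theorem IsBridge.exists_btr {S : Signature} {A B : Type} [SAlg S A] [SAlg S B]
    {ρ : Set (A × A)} {σ : Set (B × B)} {T : Set (A × A × B × B)} (hT : IsBridge S ρ σ T)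
    (hρ : IsCongruence S ρ) (hσ : IsCongruence S σ) (a : A) : ∃ b, (a, b) ∈ btr T := by
  obtain ⟨-, -, hr, hpr, -, hiff⟩ := hT
  obtain ⟨b₁, b₂, h⟩ := hpr.1 (hρ.2.refl a)
  exact ⟨b₁, hr _ _ _ _ _ _ h (hσ.2.refl _)
    (hσ.2.symm ((hiff _ _ _ _ h).1 (hρ.2.refl a)))⟩

/-- A compatible relation which is total, onto, and matches `ρ` with `σ` induces an isomorphism
of the quotients. -/
theorem isoAlgI_of_rel {S : Signature} {A B : Type} [iA : SAlg S A] [iB : SAlg S B]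
    {ρ : Set (A × A)} {σ : Set (B × B)} (hρ : IsCongruence S ρ) (hσ : IsCongruence S σ)
    {γ : Set (A × B)} (hγ : IsSubuniverse S γ) (hl : ∀ a, ∃ b, (a, b) ∈ γ)
    (hr : ∀ b, ∃ a, (a, b) ∈ γ)
    (hiff : ∀ a b a' b', (a, b) ∈ γ → (a', b') ∈ γ → ((a, a') ∈ ρ ↔ (b, b') ∈ σ)) :
    IsoAlgI (quotAlg iA ρ) (quotAlg iB σ) := by
  choose g hg using hl
  obtain ⟨f, hf⟩ : ∃ f : ConQuot ρ → ConQuot σ, ∀ a b, (a, b) ∈ γ →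
      f (ConQuot.mk ρ a) = ConQuot.mk σ b :=
    ⟨Quot.lift (fun a => ConQuot.mk σ (g a)) fun a a' h =>
      (ConQuot.mk_eq_iff hσ).2 ((hiff _ _ _ _ (hg a) (hg a')).1 h),
      fun a b h => (ConQuot.mk_eq_iff hσ).2 ((hiff _ _ _ _ (hg a) h).1 (hρ.2.refl a))⟩
  have hbij : Function.Bijective f := by
    constructor
    · intro x y hxy
      obtain ⟨a, rfl⟩ := ConQuot.mk_surjective x
      obtain ⟨a', rfl⟩ := ConQuot.mk_surjective y
      rw [hf _ _ (hg a), hf _ _ (hg a')] at hxy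
      exact (ConQuot.mk_eq_iff hρ).2
        ((hiff _ _ _ _ (hg a) (hg a')).2 ((ConQuot.mk_eq_iff hσ).1 hxy))
    · intro y
      obtain ⟨b, rfl⟩ := ConQuot.mk_surjective y
      obtain ⟨a, ha⟩ := hr b
      exact ⟨_, hf a b ha⟩
  refine ⟨Equiv.ofBijective f hbij, fun o x => ?_⟩
  choose a ha using fun i => ConQuot.mk_surjective (x i)
  obtain rfl : (fun i => ConQuot.mk ρ (a i)) = x := funext ha
  simp only [Equiv.ofBijective_apply, hf _ _ (hg _)]
  rw [quotAlg_interp hρ, hf _ _ (hγ o (fun i => (a i, g (a i))) fun i => hg (a i))]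
  exact (quotAlg_interp hσ o fun i => g (a i)).symm

end Zhuk

/-- if `ρ⁺/ρ` and `σ⁺/σ` are nonabelian and there is a good bridge from
`(A,ρ)` to `(B,σ)`, then `A/ρ ≅ B/σ`. -/
theorem stmt_15 {S : Zhuk.Signature} {A B : Type} [iA : Zhuk.SAlg S A] [iB : Zhuk.SAlg S B]
    [Finite A] [Finite B]
    (hTay : Zhuk.CommonTaylor S A B)
    (ρ ρplus : Set (A × A)) (σ σplus : Set (B × B))
    (hρ : Zhuk.MeetIrredWith S ρ ρplus) (hσ : Zhuk.MeetIrredWith S σ σplus)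
    (hnabρ : ¬ Zhuk.Centralizes S ρplus ρplus ρ)
    (hnabσ : ¬ Zhuk.Centralizes S σplus σplus σ)
    (T : Set (A × A × B × B)) (hT : Zhuk.GoodBridge S ρ ρplus σ σplus T) :
    Zhuk.IsoAlgI (Zhuk.quotAlg iA ρ) (Zhuk.quotAlg iB σ) := by
  obtain ⟨-, τ, hτ, τ', hτ', T', -, ⟨hB, h12, h34⟩, -⟩ := hT
  have hleft : ∀ {a a' b}, (a, b) ∈ Zhuk.btr T' → (a', b) ∈ Zhuk.btr T' → (a, a') ∈ ρ :=
    Zhuk.btr_left_unique hρ hnabρ hB (h12 ▸ hτ.2)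
  have hright : ∀ {a b b'}, (a, b) ∈ Zhuk.btr T' → (a, b') ∈ Zhuk.btr T' → (b, b') ∈ σ :=
    Zhuk.btr_left_unique hσ hnabσ hB.conv (show Zhuk.pr34 T' ⊆ σplus from h34 ▸ hτ'.2)
  refine Zhuk.isoAlgI_of_rel hρ.1 hσ.1 (γ := Zhuk.btr T')
    (fun o x hx => hB.1 o (fun i => ((x i).1, (x i).1, (x i).2, (x i).2)) hx)
    (hB.exists_btr hρ.1 hσ.1) (hB.conv.exists_btr hσ.1 hρ.1) fun a b a' b' h h' => ⟨?_, ?_⟩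
  · intro haa'
    exact hright (hB.2.1 a a b b a' a' h haa' haa') h'
  · intro hbb'
    exact hleft (hB.2.2.1 a a b b b' b' h hbb' hbb') h'
end

section
/- Let A be a finite subdirectly irreducible Taylor algebra with abelian monolith μ, and let α = (0 : μ). Then T^opt_{(A,0)} = Δ♭_{μ,α} = T_D(A) ∘ (T_D(A))^∪, where T_D(A) = {(a, b, (a,e)/Δ_{μ,α}, (b,e)/Δ_{μ,α}) : a ≡_μ b ≡_μ e}. -/
namespace Zhuk

/-! ### Clones generated by one operation -/

/-- Membership in the clone generated by the single operation `t`. -/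
inductive Gen {B : Type} {n : ℕ} (t : (Fin n → B) → B) {m : ℕ} : ((Fin m → B) → B) → Prop
  | proj (i : Fin m) : Gen t fun v => v i
  | comp (f : Fin n → (Fin m → B) → B) : (∀ j, Gen t (f j)) → Gen t fun v => t fun j => f j v

/-- The clone generated by `t` satisfies the term condition: every coordinate of the matrix
with rows `(w, x)` and `(y, z)` is constant along rows or along columns. -/
def TermCondition {B : Type} {n : ℕ} (t : (Fin n → B) → B) : Prop :=
  ∀ (m : ℕ) (f : (Fin m → B) → B), Gen t f → ∀ w x y z : Fin m → B,
    (∀ i, (w i = x i ∧ y i = z i) ∨ (w i = y i ∧ x i = z i)) → f w = f x → f y = f z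

/-- `e` is a binary operation in the clone generated by `t`. -/
def Gen₂ {B : Type} {n : ℕ} (t : (Fin n → B) → B) (e : B → B → B) : Prop :=
  Gen t fun v : Fin 2 → B => e (v 0) (v 1)

/-- `p` is a ternary operation in the clone generated by `t`. -/
def Gen₃ {B : Type} {n : ℕ} (t : (Fin n → B) → B) (p : B → B → B → B) : Prop :=
  Gen t fun v : Fin 3 → B => p (v 0) (v 1) (v 2)

section Clone

variable {B : Type} {n : ℕ} {t : (Fin n → B) → B}

theorem Gen.subst {m k : ℕ} {f : (Fin m → B) → B} (hf : Gen t f)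
    {g : Fin m → (Fin k → B) → B} (hg : ∀ i, Gen t (g i)) :
    Gen t fun v => f fun i => g i v := by
  induction hf with
  | proj i => exact hg i
  | comp f _ ih => exact Gen.comp (fun j v => f j fun i => g i v) ih

theorem Gen₂.subst {e : B → B → B} (he : Gen₂ t e) {k : ℕ} {f g : (Fin k → B) → B}
    (hf : Gen t f) (hg : Gen t g) : Gen t fun v => e (f v) (g v) :=
  Gen.subst he (g := ![f, g]) (by simp [Fin.forall_fin_succ, hf, hg])

theorem Gen₃.subst {p : B → B → B → B} (hp : Gen₃ t p) {k : ℕ} {f g h : (Fin k → B) → B}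
    (hf : Gen t f) (hg : Gen t g) (hh : Gen t h) : Gen t fun v => p (f v) (g v) (h v) :=
  Gen.subst hp (g := ![f, g, h]) (by simp [Fin.forall_fin_succ, hf, hg, hh])

theorem Gen₂.swap {e : B → B → B} (he : Gen₂ t e) : Gen₂ t fun x y => e y x :=
  he.subst (.proj 1) (.proj 0)

theorem Gen₂.iterate {e : B → B → B} (he : Gen₂ t e) (k : ℕ) :
    Gen₂ t fun x y => (fun a => e a y)^[k] x := by
  induction k with
  | zero => exact .proj 0
  | succ k ih =>
    simp only [Function.iterate_succ_apply']
    exact he.subst ih (.proj 1)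

theorem Gen₃.iterate {p : B → B → B → B} (hp : Gen₃ t p) (k : ℕ) :
    Gen₃ t fun x y z => (fun a => p a y z)^[k] x := by
  induction k with
  | zero => exact .proj 0
  | succ k ih =>
    simp only [Function.iterate_succ_apply']
    exact hp.subst ih (.proj 1) (.proj 2)

theorem TermCondition.left (ht : TermCondition t) {e : B → B → B} (he : Gen₂ t e)
    {a b c : B} (d : B) (h : e a c = e b c) : e a d = e b d :=
  ht 2 _ he ![a, c] ![b, c] ![a, d] ![b, d] (by simp [Fin.forall_fin_succ]) h

theorem TermCondition.right (ht : TermCondition t) {e : B → B → B} (he : Gen₂ t e)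
    {a b c : B} (d : B) (h : e c a = e c b) : e d a = e d b :=
  ht.left he.swap d h

theorem exists_iterate_eq_id [Finite B] :
    ∃ N : ℕ, ∀ f : B → B, Function.Injective f → f^[N + 1] = id := by
  classical
  refine ⟨Nat.card (Equiv.Perm B) - 1, fun f hf => ?_⟩
  rw [Nat.sub_add_cancel Nat.card_pos]
  have h := pow_card_eq_one' (x := Equiv.ofBijective f (Finite.injective_iff_bijective.mp hf))
  change (⇑(Equiv.ofBijective f (Finite.injective_iff_bijective.mp hf)))^[_] = id
  rw [Equiv.Perm.iterate_eq_pow, h]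
  rfl

theorem exists_iterate_idempotent [Finite B] (b : B → B → B) :
    ∃ N : ℕ, ∀ x y, (fun a => b a y)^[N + 1] ((fun a => b a y)^[N + 1] x) =
      (fun a => b a y)^[N + 1] x := by
  classical
  obtain ⟨i, j, hij, h⟩ := Finite.exists_ne_map_eq_of_infinite
    (fun k : ℕ => fun y : B => (fun a => b a y)^[k])
  wlog hlt : i < j generalizing i j
  · exact this j i hij.symm h.symm (by omega)
  have step : ∀ (y : B) (k : ℕ), i ≤ k →
      (fun a => b a y)^[k + (j - i)] = (fun a => b a y)^[k] := by
    intro y k hk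
    have hy : (fun a => b a y)^[i] = (fun a => b a y)^[j] := congrFun h y
    obtain ⟨l, rfl⟩ := Nat.exists_eq_add_of_le' hk
    rw [show l + i + (j - i) = l + j by omega, Function.iterate_add, Function.iterate_add, hy]
  have steps : ∀ (y : B) (l k : ℕ), i ≤ k →
      (fun a => b a y)^[k + l * (j - i)] = (fun a => b a y)^[k] := by
    intro y l
    induction l with
    | zero => simp
    | succ l ih =>
      intro k hk
      rw [Nat.succ_mul, ← Nat.add_assoc, step y _ (by omega), ih k hk]
  have hpos : 0 < (i + 1) * (j - i) := Nat.mul_pos (by omega) (by omega)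
  refine ⟨(i + 1) * (j - i) - 1, fun x y => ?_⟩
  rw [Nat.sub_add_cancel hpos, ← Function.iterate_add_apply,
    steps y (i + 1) _ (le_trans (Nat.le_succ i) (Nat.le_mul_of_pos_right _ (by omega)))]

theorem Gen.idem (hid : ∀ a, t (fun _ => a) = a) {m : ℕ} {f : (Fin m → B) → B} (hf : Gen t f)
    (a : B) : f (fun _ => a) = a := by
  induction hf with
  | proj i => rfl
  | comp f _ ih => simp only [ih, hid]

theorem Gen₂.idem (hid : ∀ a, t (fun _ => a) = a) {e : B → B → B} (he : Gen₂ t e) (a : B) :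
    e a a = a :=
  Gen.idem hid he a

theorem Gen₃.idem (hid : ∀ a, t (fun _ => a) = a) {p : B → B → B → B} (hp : Gen₃ t p) (a : B) :
    p a a a = a :=
  Gen.idem hid hp a

theorem Gen.self : Gen t t :=
  .comp (fun j v => v j) fun j => .proj j

/-- A ternary operation of the clone that is injective in its outer variables yields a
Maltsev operation. -/
theorem exists_maltsev_of_injective [Finite B] (hid : ∀ a, t (fun _ => a) = a)
    {q : B → B → B → B} (hq : Gen₃ t q)
    (h₁ : ∀ y z, Function.Injective fun x => q x y z)
    (h₃ : ∀ x y, Function.Injective fun z => q x y z) :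
    ∃ p, Gen₃ t p ∧ ∀ x y, p x y y = x ∧ p y y x = x := by
  obtain ⟨N, hN⟩ := exists_iterate_eq_id (B := B)
  obtain ⟨p, hp, hpx, hpz⟩ : ∃ p, Gen₃ t p ∧ (∀ x y, p x y y = x) ∧
      ∀ x y, Function.Injective fun z => p x y z := by
    refine ⟨fun x y z => (fun a => q a y y)^[N] (q x y z),
      (hq.iterate N).subst hq (.proj 1) (.proj 1), fun x y => ?_, fun x y => ?_⟩
    · exact congrFun (hN _ (h₁ y y)) x
    · exact ((h₁ y y).iterate N).comp (h₃ x y)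
  have hr : Gen₂ t fun z y => p y y z := hp.subst (.proj 1) (.proj 1) (.proj 0)
  refine ⟨fun x y z => p x y ((fun a => p y y a)^[N] z),
    hp.subst (.proj 0) (.proj 1) ((hr.iterate N).subst (.proj 2) (.proj 1)), fun x y => ⟨?_, ?_⟩⟩
  · have hfix : (fun a => p y y a)^[N] y = y := Function.iterate_fixed (hp.idem hid y) N
    simp only [hfix, hpx]
  · have h := congrFun (hN _ (hpz y y)) x
    rwa [Function.iterate_succ_apply'] at h

/-- Every binary operation of the clone that is an idempotent map in its first variable is a
projection. -/
def Indecomposable {B : Type} {n : ℕ} (t : (Fin n → B) → B) : Prop :=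
  ∀ e, Gen₂ t e → (∀ x y, e (e x y) y = e x y) → (∀ x y, e x y = x) ∨ ∀ x y, e x y = y

theorem Indecomposable.injective_or_injective [Finite B] (hD : Indecomposable t)
    (ht : TermCondition t) {b : B → B → B} (hb : Gen₂ t b) :
    (∀ y, Function.Injective fun x => b x y) ∨ ∀ x, Function.Injective (b x) := by
  obtain ⟨N, hN⟩ := exists_iterate_idempotent b
  rcases hD _ (hb.iterate (N + 1)) hN with h | h
  · refine .inl fun y x x' hx => ?_
    rw [← h x y, ← h x' y, Function.iterate_succ_apply, Function.iterate_succ_apply]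
    exact congrArg _ hx
  · refine .inr fun x y y' hy => ?_
    have key : ∀ k, (fun a => b a y)^[k] x = (fun a => b a y')^[k] x := by
      intro k
      induction k with
      | zero => rfl
      | succ k ih =>
        rw [Function.iterate_succ_apply', Function.iterate_succ_apply', ih]
        exact ht.right hb _ hy
    rw [← h x y, ← h x y', key]

/-- The binary operation obtained from `t` by identifying the variables in `s` and those
outside `s`. -/
def merge {B : Type} {n : ℕ} (t : (Fin n → B) → B) (s : Finset (Fin n)) (x y : B) : B :=
  t fun j => if j ∈ s then x else y

/-- The operation `t` is injective in the block of variables `s`. -/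
def InjectiveBlock {B : Type} {n : ℕ} (t : (Fin n → B) → B) (s : Finset (Fin n)) : Prop :=
  ∀ y, Function.Injective fun x => merge t s x y

theorem gen_merge (s : Finset (Fin n)) : Gen₂ t (merge t s) :=
  .comp (fun j v => if j ∈ s then v 0 else v 1) fun j => by
    by_cases h : j ∈ s <;> simp only [h, if_true, if_false] <;> exact .proj _

/-- The ternary operation obtained from `t` by identifying the variables in `s`, those in
`s'` but not in `s`, and the remaining ones. -/
def merge₃ {B : Type} {n : ℕ} (t : (Fin n → B) → B) (s s' : Finset (Fin n)) (x y z : B) : B :=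
  t fun j => if j ∈ s then x else if j ∈ s' then y else z

theorem gen_merge₃ (s s' : Finset (Fin n)) : Gen₃ t (merge₃ t s s') :=
  .comp (fun j v => if j ∈ s then v 0 else if j ∈ s' then v 1 else v 2) fun j => by
    by_cases h : j ∈ s <;> by_cases h' : j ∈ s' <;> simp only [h, h', if_true, if_false] <;>
      exact .proj _

theorem InjectiveBlock.merge₃_left (ht : TermCondition t) {s : Finset (Fin n)}
    (hs : InjectiveBlock t s) (s' : Finset (Fin n)) (y z : B) :
    Function.Injective fun x => merge₃ t s s' x y z := by
  intro x x' h
  refine hs y (ht n t .self _ _ _ _ (fun j => ?_) h)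
  by_cases hj : j ∈ s <;> simp [hj]

theorem InjectiveBlock.merge₃_right (ht : TermCondition t) {s s' : Finset (Fin n)}
    (hs' : InjectiveBlock t s') (hd : Disjoint s s') (x z : B) :
    Function.Injective fun y => merge₃ t s s' x y z := by
  intro y y' h
  refine hs' z (ht n t .self _ _ _ _ (fun j => ?_) h)
  by_cases hj : j ∈ s
  · simp [hj, Finset.disjoint_left.mp hd hj]
  · by_cases hj' : j ∈ s' <;> simp [hj, hj']

theorem exists_maltsev_of_disjoint [Finite B] (ht : TermCondition t)
    (hid : ∀ a, t (fun _ => a) = a) {s s' : Finset (Fin n)} (hd : Disjoint s s')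
    (hs : InjectiveBlock t s) (hs' : InjectiveBlock t s') :
    ∃ p, Gen₃ t p ∧ ∀ x y, p x y y = x ∧ p y y x = x :=
  exists_maltsev_of_injective hid (q := fun x y z => merge₃ t s s' x z y)
    ((gen_merge₃ s s').subst (.proj 0) (.proj 2) (.proj 1))
    (fun y z => hs.merge₃_left ht s' z y) fun x y => hs'.merge₃_right ht hd x y

theorem Indecomposable.injectiveBlock_or_compl [Finite B] (hD : Indecomposable t)
    (ht : TermCondition t) (s : Finset (Fin n)) : InjectiveBlock t s ∨ InjectiveBlock t sᶜ := by
  refine (hD.injective_or_injective ht (gen_merge s)).imp id fun h y x x' hx => h y ?_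
  simpa [merge, ite_not] using hx

theorem Indecomposable.injectiveBlock_of_union [Finite B] (hD : Indecomposable t)
    (ht : TermCondition t) {s s' : Finset (Fin n)} (hd : Disjoint s s')
    (hs : InjectiveBlock t (s ∪ s')) : InjectiveBlock t s ∨ InjectiveBlock t s' := by
  obtain ⟨N, hN⟩ := exists_iterate_eq_id (B := B)
  have hg := gen_merge₃ (t := t) s s'
  set g := merge₃ t s s' with hgdef
  have hdiag : ∀ x z, g x x z = merge t (s ∪ s') x z := by
    intro x z
    simp only [hgdef, merge₃, merge, Finset.mem_union]
    congr 1; funext j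
    by_cases hj : j ∈ s <;> simp [hj]
  have hinj : ∀ z, Function.Injective fun x => g x x z :=
    fun z => by simpa only [hdiag] using hs z
  have hβ : Gen₂ t fun x z => g x x z := hg.subst (.proj 0) (.proj 0) (.proj 1)
  have hh : Gen₃ t fun x y z => (fun a => g a a z)^[N] (g x y z) :=
    (hβ.iterate N).subst hg (.proj 2)
  set h := fun x y z => (fun a => g a a z)^[N] (g x y z) with hhdef
  have hxx : ∀ x z, h x x z = x := fun x z => congrFun (hN _ (hinj z)) x
  have hz : ∀ x y z z', h x y z = h x y z' := fun x y z z' =>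
    ht 3 _ hh ![x, x, z] ![x, x, z'] ![x, y, z] ![x, y, z'] (by simp [Fin.forall_fin_succ])
      (by simp [hxx])
  have hb : Gen₂ t fun x y => h x y y := hh.subst (.proj 0) (.proj 1) (.proj 1)
  refine (hD.injective_or_injective ht hb).imp (fun hl y x x' hx => hl y ?_)
    fun hr x y y' hy => hr x ?_
  · have hgx : g x y y = g x' y y := by simpa [hgdef, merge₃, merge] using hx
    simp only [hhdef, hgx]
  · have key : ∀ y, g x y x = merge t s' y x := by
      intro y
      simp only [hgdef, merge₃, merge]
      congr 1; funext j
      by_cases hj : j ∈ s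
      · simp [hj, Finset.disjoint_left.mp hd hj]
      · simp [hj]
    have hgy : g x y x = g x y' x := by rw [key, key]; exact hy
    change h x y y = h x y' y'
    rw [hz x y y x, hz x y' y' x]
    simp only [hhdef, hgy]

theorem Indecomposable.exists_injectiveBlock_singleton [Finite B] [Nontrivial B]
    (hD : Indecomposable t) (ht : TermCondition t) {s : Finset (Fin n)}
    (hs : InjectiveBlock t s) : ∃ i, InjectiveBlock t {i} := by
  induction s using Finset.induction_on with
  | empty =>
    obtain ⟨x, y, hxy⟩ := exists_pair_ne B
    exact absurd (hs x (by simp [merge] : merge t ∅ x x = merge t ∅ y x)) hxy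
  | insert a s ha ih =>
    rw [Finset.insert_eq] at hs
    exact (hD.injectiveBlock_of_union ht (Finset.disjoint_singleton_left.mpr ha) hs).elim
      (fun h => ⟨a, h⟩) ih

/-- `t` is idempotent and satisfies Taylor identities with data `u`, `v`. -/
structure IsTaylorOp {B : Type} {n : ℕ} (t : (Fin n → B) → B) (u v : Fin n → Fin n → Fin 2) :
    Prop where
  idem : ∀ a, t (fun _ => a) = a
  ident : ∀ (i : Fin n) (x y : B),
    t (fun j => if u i j = 0 then x else y) = t fun j => if v i j = 0 then x else y

theorem Indecomposable.exists_maltsev [Finite B] (hD : Indecomposable t)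
    (ht : TermCondition t) {u v : Fin n → Fin n → Fin 2} (huv : ∀ i, u i i ≠ v i i)
    (hT : IsTaylorOp t u v) : ∃ p, Gen₃ t p ∧ ∀ x y, p x y y = x ∧ p y y x = x := by
  rcases subsingleton_or_nontrivial B with hB | hB
  · exact ⟨fun x _ _ => x, .proj 0, fun x y => ⟨rfl, hB.elim _ _⟩⟩
  have huniv : InjectiveBlock t Finset.univ := fun y x x' h => by
    simpa [merge, hT.idem] using h
  obtain ⟨i, hi⟩ := hD.exists_injectiveBlock_singleton ht huniv
  by_contra hno
  have hiff : ∀ s : Finset (Fin n), InjectiveBlock t s ↔ i ∈ s := by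
    intro s
    refine ⟨fun h => ?_, fun h => ?_⟩
    · by_contra his
      exact hno (exists_maltsev_of_disjoint ht hT.idem
        (Finset.disjoint_singleton_left.mpr his) hi h)
    · refine (hD.injectiveBlock_or_compl ht s).resolve_right fun hc => hno ?_
      exact exists_maltsev_of_disjoint ht hT.idem
        (Finset.disjoint_singleton_left.mpr (by simpa using h)) hi hc
  have heq : merge t {j | u i j = 0} = merge t {j | v i j = 0} := by
    funext x y
    simpa [merge] using hT.ident i x y
  have h0 : u i i = 0 ↔ v i i = 0 := by
    have hu := hiff {j | u i j = 0}
    have hv := hiff {j | v i j = 0}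
    simp only [Finset.mem_filter_univ] at hu hv
    rw [← hu, ← hv, InjectiveBlock, InjectiveBlock, heq]
  have := huv i
  omega

/-- If `e` is a binary operation of the clone that is a nontrivial idempotent map in its first
variable, then the clone contains a Maltsev operation for the range of `e`, provided that
smaller algebras have Maltsev operations. -/
theorem exists_maltsev_on_range [Finite B] (ht : TermCondition t)
    {u v : Fin n → Fin n → Fin 2} (hT : IsTaylorOp t u v)
    (ih : ∀ (N : Type) [Finite N] (r : (Fin n → N) → N), Nat.card N < Nat.card B →
      TermCondition r → IsTaylorOp r u v → ∃ p, Gen₃ r p ∧ ∀ x y, p x y y = x ∧ p y y x = x)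
    {e : B → B → B} (he : Gen₂ t e) (hee : ∀ x y, e (e x y) y = e x y)
    (hne : ∃ x y, e x y ≠ x) :
    ∃ p, Gen₃ t p ∧ ∀ x y, p x y y = e x y ∧ p y y x = e x y := by
  have hez : ∀ x y z, e (e x y) z = e x z := fun x y z => ht.left he z (hee x y)
  obtain ⟨a, o, hao⟩ := hne
  let N := {x : B // e x o = x}
  let r : (Fin n → N) → N := fun x => ⟨e (t fun j => (x j).1) o, hee _ _⟩
  have lift : ∀ (m : ℕ) (f : (Fin m → N) → N), Gen r f → ∃ F : (Fin (m + 1) → B) → B, Gen t F ∧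
      (∀ x, (f x).1 = F (Fin.cons o fun i => (x i).1)) ∧
      ∀ c w, F (Fin.cons w fun _ => e c w) = e c w := by
    intro m f hf
    induction hf with
    | proj i => exact ⟨fun v => v i.succ, .proj _, fun x => rfl, fun c w => rfl⟩
    | comp f _ ih =>
      choose F hF hFx hFc using ih
      refine ⟨fun v => e (t fun j => F j v) (v 0), he.subst (.comp F hF) (.proj 0),
        fun x => ?_, fun c w => ?_⟩
      · simp only [r, hFx, Fin.cons_zero]
      · simp only [hFc, hT.idem, Fin.cons_zero, hee]
  have hcard : Nat.card N < Nat.card B := Finite.card_subtype_lt hao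
  have hr : TermCondition r := by
    intro m f hf w x y z hrel h
    obtain ⟨F, hF, hFx, -⟩ := lift m f hf
    refine Subtype.ext ?_
    rw [hFx, hFx]
    refine ht _ F hF (Fin.cons o fun i => (w i).1) (Fin.cons o fun i => (x i).1) _ _ ?_ ?_
    · refine Fin.cases (.inl ⟨rfl, rfl⟩) fun i => ?_
      rcases hrel i with ⟨h₁, h₂⟩ | ⟨h₁, h₂⟩ <;> simp [h₁, h₂]
    · rw [← hFx, ← hFx, h]
  have hrT : IsTaylorOp r u v := by
    refine ⟨fun a => Subtype.ext ?_, fun i x y => Subtype.ext ?_⟩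
    · simp only [r, hT.idem, a.2]
    · simp only [r, apply_ite Subtype.val, hT.ident i]
  obtain ⟨q, hq, hqm⟩ := ih N r hcard hr hrT
  obtain ⟨F, hF, hFx, hFc⟩ := lift 3 _ hq
  let K : (Fin 5 → B) → B :=
    fun v => e (F ![v 3, e (v 0) (v 3), e (v 1) (v 3), e (v 2) (v 3)]) (v 4)
  have hK : Gen t K := by
    refine he.subst ?_ (.proj 4)
    have := hF.subst (g := ![fun v : Fin 5 → B => v 3, fun v => e (v 0) (v 3),
      fun v => e (v 1) (v 3), fun v => e (v 2) (v 3)]) (by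
        simp only [Fin.forall_fin_succ]
        exact ⟨.proj 3, he.subst (.proj 0) (.proj 3), he.subst (.proj 1) (.proj 3),
          he.subst (.proj 2) (.proj 3), fun i => i.elim0⟩)
    refine (congrArg (Gen t) (funext fun v => congrArg F (funext fun i => ?_))).mp this
    fin_cases i <;> rfl
  have hKc : ∀ c w d, K ![c, c, c, w, d] = e c d := by
    intro c w d
    have hvec : ![w, e c w, e c w, e c w] = Fin.cons w fun _ => e c w := by
      funext i
      fin_cases i <;> rfl
    change e (F ![w, e c w, e c w, e c w]) d = e c d
    rw [hvec, hFc, hez]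
  have hKo : ∀ x y z w d, K ![x, y, z, w, d] = K ![x, y, z, o, d] := fun x y z w d =>
    ht 5 K hK ![x, x, x, w, d] ![x, x, x, o, d] _ _ (by simp [Fin.forall_fin_succ])
      (by rw [hKc, hKc])
  have hKq : ∀ x y z d, K ![x, y, z, o, d] =
      e (q ⟨e x o, hee _ _⟩ ⟨e y o, hee _ _⟩ ⟨e z o, hee _ _⟩).1 d := by
    intro x y z d
    have h := hFx ![⟨e x o, hee _ _⟩, ⟨e y o, hee _ _⟩, ⟨e z o, hee _ _⟩]
    refine congrArg (fun b => e b d) (Eq.trans ?_ h.symm)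
    change F ![o, e x o, e y o, e z o] = _
    congr 1
    funext i
    fin_cases i <;> rfl
  refine ⟨fun x y z => K ![x, y, z, y, y], ?_, fun x y => ⟨?_, ?_⟩⟩
  · have := hK.subst (g := ![fun v : Fin 3 → B => v 0, fun v => v 1, fun v => v 2, fun v => v 1,
      fun v => v 1]) (by
        simp only [Fin.forall_fin_succ]
        exact ⟨.proj 0, .proj 1, .proj 2, .proj 1, .proj 1, fun i => i.elim0⟩)
    exact (congrArg (Gen t) (funext fun v => by congr 1)).mp this
  · beta_reduce
    rw [hKo, hKq, (hqm _ _).1, hez]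
  · beta_reduce
    rw [hKo, hKq, (hqm _ _).2, hez]

end Clone

/-- A finite abelian idempotent Taylor algebra has a Maltsev term. -/
theorem IsTaylorOp.exists_maltsev {n : ℕ} {u v : Fin n → Fin n → Fin 2}
    (huv : ∀ i, u i i ≠ v i i) {B : Type} [Finite B] {t : (Fin n → B) → B}
    (ht : TermCondition t) (hT : IsTaylorOp t u v) :
    ∃ p, Gen₃ t p ∧ ∀ x y, p x y y = x ∧ p y y x = x := by
  induction hk : Nat.card B using Nat.strong_induction_on generalizing B with
  | _ k ih =>
    by_cases hD : Indecomposable t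
    · exact hD.exists_maltsev ht huv hT
    have ih' : ∀ (N : Type) [Finite N] (r : (Fin n → N) → N), Nat.card N < Nat.card B →
        TermCondition r → IsTaylorOp r u v →
        ∃ p, Gen₃ r p ∧ ∀ x y, p x y y = x ∧ p y y x = x :=
      fun N _ r hN hr hrT => ih _ (hk ▸ hN) hr hrT rfl
    simp only [Indecomposable, not_forall, not_or] at hD
    obtain ⟨e, he, hee, ⟨a, b, hab⟩, ⟨c, d, hcd⟩⟩ := hD
    have hez : ∀ x y z, e (e x y) z = e x z := fun x y z => ht.left he z (hee x y)
    have hee' : ∀ x y, e x (e x y) = e x y := fun x y => by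
      rw [← hez x y (e x y), he.idem hT.idem]
    have hez' : ∀ x y z, e z (e x y) = e z y := fun x y z => ht.right he z (hee' x y)
    obtain ⟨p, hp, hpm⟩ := exists_maltsev_on_range ht hT ih' he hee ⟨a, b, hab⟩
    obtain ⟨p', hp', hpm'⟩ := exists_maltsev_on_range ht hT ih' he.swap
      (fun x y => hee' y x) ⟨d, c, hcd⟩
    refine ⟨fun x y z => e (p x y z) (p' x y z), he.subst hp hp', fun x y => ⟨?_, ?_⟩⟩
    · beta_reduce
      rw [(hpm x y).1, (hpm' x y).1, hez, hez', he.idem hT.idem]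
    · beta_reduce
      rw [(hpm x y).2, (hpm' x y).2, hez, hez', he.idem hT.idem]

/-! ### Terms, the centralizer and the congruence `Δ` -/

section Congruence

variable {S : Signature} {A : Type} [SAlg S A]

/-- Substitution of terms for the variables of a term. -/
def STerm.subst {n m : ℕ} : STerm S n → (Fin n → STerm S m) → STerm S m
  | .var i, g => g i
  | .app o ts, g => .app o fun i => (ts i).subst g

theorem STerm.eval_subst {n m : ℕ} (T : STerm S n) (g : Fin n → STerm S m) (v : Fin m → A) :
    (T.subst g).eval v = T.eval fun i => (g i).eval v := by
  induction T with
  | var i => rfl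
  | app o ts ih => simp only [STerm.subst, STerm.eval, ih]

theorem STerm.eval_prod {B : Type} [SAlg S B] {n : ℕ} (T : STerm S n) (x : Fin n → A)
    (y : Fin n → B) : T.eval (fun i => (x i, y i)) = (T.eval x, T.eval y) := by
  induction T with
  | var i => rfl
  | app o ts ih =>
    simp only [STerm.eval, ih]
    rfl

theorem IsSubuniverse.eval_mem {R : Set A} (hR : IsSubuniverse S R) {n : ℕ} (T : STerm S n)
    {v : Fin n → A} (hv : ∀ i, v i ∈ R) : T.eval v ∈ R := by
  induction T with
  | var i => exact hv i
  | app o ts ih => exact hR o _ ih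

/-- The term condition with several variables changing along `φ`. -/
theorem Centralizes.eval_eq {φ θ : Set (A × A)} (h : Centralizes S φ θ (diag A))
    (hθ : ∀ a, (a, a) ∈ θ) {m : ℕ} (T : STerm S m) {w x y z : Fin m → A}
    (hrel : ∀ i, (w i = x i ∧ y i = z i ∧ (w i, y i) ∈ φ) ∨
      (w i = y i ∧ x i = z i ∧ (w i, x i) ∈ θ))
    (hwx : T.eval w = T.eval x) : T.eval y = T.eval z := by
  suffices key : ∀ s : Finset (Fin m),
      T.eval (fun i => if i ∈ s then y i else w i) =
        T.eval fun i => if i ∈ s then z i else x i by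
    simpa using key Finset.univ
  intro s
  induction s using Finset.induction_on with
  | empty => simpa using hwx
  | insert i s hi ih =>
    rcases hrel i with ⟨h₁, h₂, h₃⟩ | ⟨h₁, h₂, -⟩
    · let T' : STerm S (m + 1) := T.subst fun j => if j = i then .var 0 else .var j.succ
      have hT' : ∀ (a : A) (c : Fin m → A),
          T'.eval (Fin.cons a c) = T.eval fun j => if j = i then a else c j := by
        intro a c
        rw [STerm.eval_subst]
        congr 1
        funext j
        split_ifs <;> rfl
      have := h m T' (w i) (y i) (fun j => if j ∈ s then y j else w j)
        (fun j => if j ∈ s then z j else x j) h₃ (fun j => ?_) ?_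
      · simp only [diag, Set.mem_ofPred_eq, hT'] at this
        convert this using 2 <;> funext j <;> by_cases hj : j = i <;> simp [hj, ← h₂]
      · rcases hrel j with ⟨g₁, g₂, -⟩ | ⟨g₁, g₂, g₃⟩
        · simp only [g₁, g₂, hθ]
        · split_ifs
          · rwa [← g₁, ← g₂]
          · exact g₃
      · simp only [diag, Set.mem_ofPred_eq, hT']
        convert ih using 2 <;> funext j <;> by_cases hj : j = i <;> simp [hj, hi, h₁]
    · convert ih using 2 <;> funext j <;> by_cases hj : j = i <;> simp [hj, hi, h₁, h₂]

/-- The largest relation `φ` with `C(φ, θ; 0)`. -/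
def centralizerRel (S : Signature) {A : Type} [SAlg S A] (θ : Set (A × A)) : Set (A × A) :=
  {p | ∀ (n : ℕ) (t : STerm S (n + 1)) (c d : Fin n → A), (∀ i, (c i, d i) ∈ θ) →
    (t.eval (Fin.cons p.1 c) = t.eval (Fin.cons p.1 d) ↔
      t.eval (Fin.cons p.2 c) = t.eval (Fin.cons p.2 d))}

theorem centralizes_centralizerRel (θ : Set (A × A)) :
    Centralizes S (centralizerRel S θ) θ (diag A) :=
  fun n t _ _ c d hab hcd h => (hab n t c d hcd).mp h

theorem isCongruence_centralizerRel {θ : Set (A × A)} (hθ : ∀ a, (a, a) ∈ θ) :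
    IsCongruence S (centralizerRel S θ) := by
  have hsymm : ∀ a b, (a, b) ∈ centralizerRel S θ → (b, a) ∈ centralizerRel S θ :=
    fun a b h n t c d hcd => (h n t c d hcd).symm
  have hop : ∀ (o : S.ops) (a b : Fin (S.arity o) → A), (∀ i, (a i, b i) ∈ centralizerRel S θ) →
      ∀ (n : ℕ) (t : STerm S (n + 1)) (c d : Fin n → A), (∀ i, (c i, d i) ∈ θ) →
        t.eval (Fin.cons (SAlg.interp o a) c) = t.eval (Fin.cons (SAlg.interp o a) d) →
        t.eval (Fin.cons (SAlg.interp o b) c) = t.eval (Fin.cons (SAlg.interp o b) d) := by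
    intro o a b hab n t c d hcd h
    let T : STerm S (S.arity o + n) := t.subst
      (Fin.cons (.app o fun i => .var (Fin.castAdd n i)) fun j => .var (Fin.natAdd _ j))
    have hT : ∀ (a : Fin (S.arity o) → A) (c : Fin n → A),
        T.eval (Fin.append a c) = t.eval (Fin.cons (SAlg.interp o a) c) := by
      intro a c
      rw [STerm.eval_subst]
      congr 1
      funext j
      refine Fin.cases ?_ (fun j => ?_) j <;> simp [STerm.eval]
    rw [← hT, ← hT] at h ⊢
    refine (centralizes_centralizerRel θ).eval_eq hθ T (fun i => ?_) h
    refine Fin.addCases (fun i => .inl ?_) (fun i => .inr ?_) i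
    · simpa using hab i
    · simpa using hcd i
  refine ⟨fun o x hx n t c d hcd => ⟨hop o _ _ hx n t c d hcd,
    hop o _ _ (fun i => hsymm _ _ (hx i)) n t c d hcd⟩,
    fun a n t c d _ => Iff.rfl, fun h => hsymm _ _ h,
    fun h₁ h₂ n t c d hcd => (h₁ n t c d hcd).trans (h₂ n t c d hcd)⟩

theorem centralizer_eq_centralizerRel {θ : Set (A × A)} (hθ : ∀ a, (a, a) ∈ θ) :
    centralizer S (diag A) θ = centralizerRel S θ := by
  refine Set.Subset.antisymm ?_ fun p hp =>
    ⟨_, ⟨isCongruence_centralizerRel hθ, centralizes_centralizerRel θ⟩, hp⟩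
  rintro ⟨a, b⟩ ⟨φ, ⟨hφ, hc⟩, hab⟩ n t c d hcd
  exact ⟨hc n t a b c d hab hcd, hc n t b a c d (hφ.2.symm hab) hcd⟩

/-- In a finite Taylor algebra there is a term that is Maltsev on the blocks of a given
abelian congruence. -/
theorem IsTaylorAlg.exists_maltsev_on_blocks [Finite A] (hTay : IsTaylorAlg S A)
    {μ : Set (A × A)} (hμ : IsCongruence S μ) (hab : Centralizes S μ μ (diag A)) :
    ∃ P : STerm S 3, ∀ x y, (x, y) ∈ μ → P.eval ![x, y, y] = x ∧ P.eval ![y, y, x] = x := by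
  classical
  obtain ⟨n, T, u, v, -, huv, hid, hident⟩ := hTay
  let B := {f : A → A // ∀ a, (a, f a) ∈ μ}
  let t : (Fin n → B) → B := fun x => ⟨fun a => T.eval fun j => (x j).1 a, fun a => by
    have h := hμ.1.eval_mem T (v := fun j => (a, (x j).1 a)) fun j => (x j).2 a
    rwa [STerm.eval_prod T (fun _ => a), hid] at h⟩
  have lift : ∀ (m : ℕ) (f : (Fin m → B) → B), Gen t f →
      ∃ P : STerm S m, ∀ v a, (f v).1 a = P.eval fun i => (v i).1 a := by
    intro m f hf
    induction hf with
    | proj i => exact ⟨.var i, fun v a => rfl⟩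
    | comp f _ ih =>
      choose P hP using ih
      exact ⟨T.subst P, fun v a => by simp only [t, STerm.eval_subst, hP]⟩
  have ht : TermCondition t := by
    intro m f hf w x y z hrel h
    obtain ⟨P, hP⟩ := lift m f hf
    refine Subtype.ext (funext fun a => ?_)
    have hμa : ∀ b c : B, (b.1 a, c.1 a) ∈ μ := fun b c => hμ.2.trans (hμ.2.symm (b.2 a)) (c.2 a)
    rw [hP, hP]
    refine hab.eval_eq hμ.2.refl P (w := fun i => (w i).1 a) (x := fun i => (x i).1 a)
      (fun i => ?_) (by rw [← hP, ← hP, h])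
    rcases hrel i with ⟨h₁, h₂⟩ | ⟨h₁, h₂⟩
    · exact .inl ⟨by rw [h₁], by rw [h₂], hμa _ _⟩
    · exact .inr ⟨by rw [h₁], by rw [h₂], hμa _ _⟩
  have hT : IsTaylorOp t u v := by
    refine ⟨fun f => Subtype.ext (funext fun a => hid _),
      fun i f g => Subtype.ext (funext fun a => ?_)⟩
    have := hident i (f.1 a) (g.1 a)
    simp only [t]
    convert this using 3 <;> split_ifs <;> rfl
  obtain ⟨p, hp, hpm⟩ := IsTaylorOp.exists_maltsev huv ht hT
  obtain ⟨P, hP⟩ := lift 3 _ hp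
  refine ⟨P, fun x y hxy => ?_⟩
  let f : B := ⟨id, hμ.2.refl⟩
  let g : B := ⟨fun a => if a = x then y else a, fun a => by
    beta_reduce
    split_ifs with h
    · exact h ▸ hxy
    · exact hμ.2.refl a⟩
  have hgx : g.1 x = y := if_pos rfl
  have key : ∀ b c d : B, (p b c d).1 x = P.eval ![b.1 x, c.1 x, d.1 x] := by
    intro b c d
    refine (hP ![b, c, d] x).trans (congrArg _ (funext fun i => ?_))
    fin_cases i <;> rfl
  have h₁ := key f g g
  have h₂ := key g g f
  rw [(hpm f g).1, hgx] at h₁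
  rw [(hpm f g).2, hgx] at h₂
  exact ⟨h₁.symm, h₂.symm⟩

theorem isConOn_prod {μ : Set (A × A)} (hμ : IsCongruence S μ) : IsConOn S μ (μ ×ˢ μ) :=
  ⟨subset_rfl, fun o _ hx => ⟨hμ.1 o _ fun i => (hx i).1, hμ.1 o _ fun i => (hx i).2⟩,
    fun _ hp => ⟨hp, hp⟩, fun _ _ h => ⟨h.2, h.1⟩, fun _ _ _ h₁ h₂ => ⟨h₁.1, h₂.2⟩⟩

theorem isConOn_deltaCon {μ : Set (A × A)} (hμ : IsCongruence S μ) (α : Set (A × A)) :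
    IsConOn S μ (DeltaCon S μ α) := by
  refine ⟨fun p hp => hp _ ⟨isConOn_prod hμ, fun a b _ => ⟨hμ.2.refl a, hμ.2.refl b⟩⟩,
    fun o x hx Δ hΔ => hΔ.1.2.1 o x fun i => hx i Δ hΔ,
    fun p hp Δ hΔ => hΔ.1.2.2.1 p hp,
    fun p q h Δ hΔ => hΔ.1.2.2.2.1 p q (h Δ hΔ),
    fun p q r h₁ h₂ Δ hΔ => hΔ.1.2.2.2.2 p q r (h₁ Δ hΔ) (h₂ Δ hΔ)⟩

theorem diag_mem_deltaCon {μ α : Set (A × A)} {a b : A} (h : (a, b) ∈ α) :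
    ((a, a), (b, b)) ∈ DeltaCon S μ α :=
  fun _ hΔ => hΔ.2 a b h

theorem swap_mem_deltaCon {μ α : Set (A × A)} (hμ : IsCongruence S μ) {a b c d : A}
    (h : ((a, b), (c, d)) ∈ DeltaCon S μ α) : ((b, a), (d, c)) ∈ DeltaCon S μ α := by
  intro Δ hΔ
  obtain ⟨⟨hsub, hop, hrefl, hsymm, htrans⟩, hgen⟩ := hΔ
  have hcon : IsConOn S μ {p | (p.1.swap, p.2.swap) ∈ Δ} :=
    ⟨fun p hp => ⟨hμ.2.symm (hsub hp).1, hμ.2.symm (hsub hp).2⟩, fun o x hx => hop o _ hx,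
      fun p hp => hrefl _ (hμ.2.symm hp), fun p q hpq => hsymm _ _ hpq,
      fun p q r h₁ h₂ => htrans _ _ _ h₁ h₂⟩
  exact h _ ⟨hcon, hgen⟩

theorem snd_mem_of_mem_deltaCon {μ α : Set (A × A)} (hμ : IsCongruence S μ)
    (hα : IsCongruence S α) {a b c d : A} (h : ((a, b), (c, d)) ∈ DeltaCon S μ α) :
    (b, d) ∈ α := by
  obtain ⟨hsub, hop, hrefl, hsymm, htrans⟩ := isConOn_prod hμ
  have hcon : IsConOn S μ {p | p ∈ μ ×ˢ μ ∧ (p.1.2, p.2.2) ∈ α} :=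
    ⟨fun p hp => hp.1, fun o x hx => ⟨hop o x fun i => (hx i).1, hα.1 o _ fun i => (hx i).2⟩,
      fun p hp => ⟨hrefl p hp, hα.2.refl _⟩, fun p q hpq => ⟨hsymm p q hpq.1, hα.2.symm hpq.2⟩,
      fun p q r h₁ h₂ => ⟨htrans p q r h₁.1 h₂.1, hα.2.trans h₁.2 h₂.2⟩⟩
  exact (h _ ⟨hcon, fun a b hab => ⟨⟨hμ.2.refl a, hμ.2.refl b⟩, hab⟩⟩).2

theorem DCar.mk_eq_mk_iff {μ : Set (A × A)} (hμ : IsCongruence S μ) (α : Set (A × A))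
    {p q : ↥μ} : DCar.mk S A μ α p = DCar.mk S A μ α q ↔
      ((p : A × A), (q : A × A)) ∈ DeltaCon S μ α := by
  obtain ⟨-, -, hrefl, hsymm, htrans⟩ := isConOn_deltaCon hμ α
  have heqv : Equivalence fun p q : ↥μ => ((p : A × A), (q : A × A)) ∈ DeltaCon S μ α :=
    ⟨fun p => hrefl _ p.2, fun h => hsymm _ _ h, fun h₁ h₂ => htrans _ _ _ h₁ h₂⟩
  exact ⟨fun h => heqv.eqvGen_iff.mp (Quot.eqvGen_exact h), fun h => Quot.sound h⟩

theorem Topt_diag {μ : Set (A × A)} (hμ : IsCongruence S μ) :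
    Topt S (diag A) μ = deltaFlat S μ (centralizer S (diag A) μ) := by
  have hsub := (isConOn_deltaCon hμ (centralizer S (diag A) μ)).1
  ext ⟨a, b, c, d⟩
  constructor
  · rintro ⟨a', b', ⟨-, -, ha, hb⟩, c', d', h, ⟨-, -, hc, hd⟩⟩
    simp only [diag, Set.mem_ofPred_eq] at ha hb hc hd
    subst ha hb hc hd
    exact h
  · intro h
    exact ⟨a, b, ⟨(hsub h).1, (hsub h).1, rfl, rfl⟩, c, d, h, (hsub h).2, (hsub h).2, rfl, rfl⟩

/-- Given a term that is Maltsev on the blocks of `μ`, differences with respect to `Δ_{μ,α}`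
may be cancelled. -/
theorem mem_deltaCon_of_common_right {μ α : Set (A × A)} (hμ : IsCongruence S μ)
    (hα : IsCongruence S α) {P : STerm S 3}
    (hP : ∀ x y, (x, y) ∈ μ → P.eval ![x, y, y] = x ∧ P.eval ![y, y, x] = x)
    {a b c d e f : A} (h₁ : ((a, e), (c, f)) ∈ DeltaCon S μ α)
    (h₂ : ((b, e), (d, f)) ∈ DeltaCon S μ α) : ((a, b), (c, d)) ∈ DeltaCon S μ α := by
  have hΔ := isConOn_deltaCon hμ α
  have hee := diag_mem_deltaCon (S := S) (μ := μ) (snd_mem_of_mem_deltaCon hμ hα h₁)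
  have h := hΔ.2.1.eval_mem P (v := ![((a, e), (c, f)), ((e, e), (f, f)), ((e, b), (f, d))])
    (by simp [Fin.forall_fin_succ, h₁, hee, swap_mem_deltaCon hμ h₂])
  have hv : (![((a, e), (c, f)), ((e, e), (f, f)), ((e, b), (f, d))] :
      Fin 3 → (A × A) × (A × A)) =
      fun i => ((![a, e, e] i, ![e, e, b] i), (![c, f, f] i, ![f, f, d] i)) := by
    funext i
    fin_cases i <;> rfl
  rw [hv, STerm.eval_prod P (fun i => (![a, e, e] i, ![e, e, b] i)), STerm.eval_prod,
    STerm.eval_prod, (hP a e (hΔ.1 h₁).1).1, (hP b e (hΔ.1 h₂).1).2, (hP c f (hΔ.1 h₁).2).1,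
    (hP d f (hΔ.1 h₂).2).2] at h
  exact h

end Congruence

end Zhuk

/-- for a finite subdirectly irreducible Taylor algebra with abelian
monolith `μ` and `α = (0:μ)`:
`T^opt_{(A,0)} = Δ♭_{μ,α} = T_{D(A)} ∘ (T_{D(A)})^∪`. -/
theorem stmt_16 {S : Zhuk.Signature} {A : Type} [Zhuk.SAlg S A] [Finite A]
    (hTay : Zhuk.IsTaylorAlg S A)
    (μ : Set (A × A)) (hμ : Zhuk.IsMonolith S μ)
    (hab : Zhuk.Centralizes S μ μ (Zhuk.diag A)) :
    Zhuk.Topt S (Zhuk.diag A) μ = Zhuk.deltaFlat S μ (Zhuk.centralizer S (Zhuk.diag A) μ) ∧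
    Zhuk.deltaFlat S μ (Zhuk.centralizer S (Zhuk.diag A) μ) =
      Zhuk.bComp (Zhuk.TDBridge S A μ (Zhuk.centralizer S (Zhuk.diag A) μ))
        (Zhuk.bConv (Zhuk.TDBridge S A μ (Zhuk.centralizer S (Zhuk.diag A) μ))) := by
  have hc := hμ.1
  have hα := Zhuk.centralizer_eq_centralizerRel (S := S) hc.2.refl ▸
    Zhuk.isCongruence_centralizerRel (S := S) hc.2.refl
  refine ⟨Zhuk.Topt_diag hc, ?_⟩
  obtain ⟨P, hP⟩ := hTay.exists_maltsev_on_blocks hc hab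
  have hsub := (Zhuk.isConOn_deltaCon hc (Zhuk.centralizer S (Zhuk.diag A) μ)).1
  ext ⟨a, b, c, d⟩
  constructor
  · intro h
    have hab' := (hsub h).1
    have hcd := (hsub h).2
    refine ⟨_, _, ⟨a, b, b, hab', hab', hc.2.refl b, rfl⟩, c, d, d, hcd, hcd, hc.2.refl d, ?_⟩
    rw [(Zhuk.DCar.mk_eq_mk_iff hc _ (p := ⟨(a, b), hab'⟩) (q := ⟨(c, d), hcd⟩)).mpr h,
      (Zhuk.DCar.mk_eq_mk_iff hc _ (p := ⟨(b, b), hc.2.refl b⟩) (q := ⟨(d, d), hc.2.refl d⟩)).mpr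
        (Zhuk.diag_mem_deltaCon (Zhuk.snd_mem_of_mem_deltaCon hc hα h))]
  · rintro ⟨_, _, ⟨a, b, e, -, hae, hbe, h⟩, ⟨c, d, f, -, hcf, hdf, h'⟩⟩
    simp only [Prod.mk.injEq] at h h'
    obtain ⟨rfl, rfl, rfl, rfl⟩ := h
    obtain ⟨rfl, rfl, h₁, h₂⟩ := h'
    exact Zhuk.mem_deltaCon_of_common_right hc hα hP ((Zhuk.DCar.mk_eq_mk_iff hc _).mp h₁)
      ((Zhuk.DCar.mk_eq_mk_iff hc _).mp h₂)
end
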